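/- For any r > 1, the reduced homology of the r-fold self-join (S²)^{*r} of the 2-sphere with complex coefficients is trivial in all positive dimensions. -/

import Mathlib

open CategoryTheory

/-- The singular chain complex functor with coefficients in `R`. -/
noncomputable def singularChainComplexFunctor (R : Type) [CommRing R] :
    TopCat ⥤ ChainComplex (ModuleCat R) ℕ :=
  TopCat.toSSet ⋙ ((SimplicialObject.whiskering _ _).obj (ModuleCat.free R)) ⋙
    AlgebraicTopology.alternatingFaceMapComplex (ModuleCat R)

/-- Singular homology with coefficients in `R`, as a functor on topological spaces. -/
noncomputable def singularHomology (R : Type) [CommRing R] (n : ℕ) : TopCat ⥤ ModuleCat R :=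
  singularChainComplexFunctor R ⋙ HomologicalComplex.homologyFunctor _ _ n


open scoped Classical

/-- Points of the `r`-fold join construction on `X`: a point of the standard `(r-1)`-simplex
(barycentric coordinates) together with `r` (not necessarily distinct) points of `X`. -/
def JoinPt (X : Type) (r : ℕ) : Type :=
  {t : Fin r → ℝ // (∀ i, 0 ≤ t i) ∧ ∑ i, t i = 1} × (Fin r → X)

/-- Two formal convex combinations are identified iff they assign the same total weight to
every point of `X` (zero-weight vertices are irrelevant and repeated points are merged). -/
def joinSetoid (X : Type) (r : ℕ) : Setoid (JoinPt X r) where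
  r a b := ∀ z : X,
    (∑ i, if a.2 i = z then a.1.1 i else 0) = ∑ i, if b.2 i = z then b.1.1 i else 0
  iseqv := ⟨fun _ _ => rfl, fun h z => (h z).symm, fun h₁ h₂ z => (h₁ z).trans (h₂ z)⟩

/-- The `r`-fold self-join `X^{*r}` of a topological space `X`: the union of all
`(r-1)`-dimensional simplices whose vertices lie on (a generically embedded copy of) `X`,
realized as the quotient of `Δ^{r-1} × X^r` identifying formal convex combinations that
coincide as weighted configurations. -/
instance (X : Type) [TopologicalSpace X] (r : ℕ) : TopologicalSpace (JoinPt X r) :=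
  inferInstanceAs (TopologicalSpace
    ({t : Fin r → ℝ // (∀ i, 0 ≤ t i) ∧ ∑ i, t i = 1} × (Fin r → X)))

def SelfJoin (X : Type) [TopologicalSpace X] (r : ℕ) : Type :=
  Quotient (joinSetoid X r)

instance (X : Type) [TopologicalSpace X] (r : ℕ) : TopologicalSpace (SelfJoin X r) :=
  instTopologicalSpaceQuotient

noncomputable section

namespace SelfJoinHomology

/-- Alternating sum of the maps induced on formal linear combinations. -/
def altSum {α β : Type} {n : ℕ} (F : Fin n → α → β) : (α →₀ ℂ) →ₗ[ℂ] (β →₀ ℂ) :=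
  ∑ j : Fin n, (-1 : ℂ) ^ (j : ℕ) • Finsupp.lmapDomain ℂ ℂ (F j)

lemma altSum_single {α β : Type} {n : ℕ} (F : Fin n → α → β) (a : α) (c : ℂ) :
    altSum F (Finsupp.single a c) =
      ∑ j : Fin n, (-1 : ℂ) ^ (j : ℕ) • Finsupp.single (F j a) c := by
  rw [altSum, LinearMap.sum_apply]
  refine Finset.sum_congr rfl (fun j _ => ?_)
  rw [LinearMap.smul_apply, Finsupp.lmapDomain_apply, Finsupp.mapDomain_single]

lemma lmapDomain_single {α β : Type} (φ : α → β) (a : α) (c : ℂ) :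
    Finsupp.lmapDomain ℂ ℂ φ (Finsupp.single a c) = Finsupp.single (φ a) c := by
  rw [Finsupp.lmapDomain_apply, Finsupp.mapDomain_single]

lemma altSum_mapDomain {α β α' β' : Type} {n : ℕ} (F : Fin n → α → β) (F' : Fin n → α' → β')
    (φ : α → α') (ψ : β → β') (h : ∀ j a, F' j (φ a) = ψ (F j a)) (x : α →₀ ℂ) :
    altSum F' (Finsupp.lmapDomain ℂ ℂ φ x) = Finsupp.lmapDomain ℂ ℂ ψ (altSum F x) := by
  induction x using Finsupp.induction_linear with
  | zero => simp
  | add x y hx hy => simp only [map_add, hx, hy]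
  | single a c =>
    rw [lmapDomain_single, altSum_single, altSum_single, map_sum]
    exact Finset.sum_congr rfl (fun j _ => by rw [h, map_smul, lmapDomain_single])

/-- Two linear maps on formal linear combinations agree if they agree on generators. -/
lemma finsupp_ext {α M : Type} [AddCommGroup M] [Module ℂ M] {f g : (α →₀ ℂ) →ₗ[ℂ] M}
    (h : ∀ a, f (Finsupp.single a 1) = g (Finsupp.single a 1)) (x : α →₀ ℂ) : f x = g x := by
  have : f = g := by
    ext a
    simpa using h a
  rw [this]

lemma supported_le_of_single {α M : Type} [AddCommGroup M] [Module ℂ M] {s : Set α}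
    {f : (α →₀ ℂ) →ₗ[ℂ] M} {N : Submodule ℂ M} (h : ∀ a ∈ s, f (Finsupp.single a 1) ∈ N)
    {x : α →₀ ℂ} (hx : x ∈ Finsupp.supported ℂ ℂ s) : f x ∈ N := by
  rw [Finsupp.supported_eq_span_single] at hx
  have : Submodule.span ℂ ((fun i => Finsupp.single i (1 : ℂ)) '' s) ≤ N.comap f := by
    rw [Submodule.span_le]
    rintro _ ⟨a, ha, rfl⟩
    exact h a ha
  exact this hx

lemma finsupp_mem_of_single {α M : Type} [AddCommGroup M] [Module ℂ M]
    {f : (α →₀ ℂ) →ₗ[ℂ] M} {N : Submodule ℂ M} (h : ∀ a, f (Finsupp.single a 1) ∈ N)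
    (x : α →₀ ℂ) : f x ∈ N :=
  supported_le_of_single (s := Set.univ) (fun a _ => h a) (by simp)

lemma eq_of_supported {α M : Type} [AddCommGroup M] [Module ℂ M] {s : Set α}
    {f g : (α →₀ ℂ) →ₗ[ℂ] M} (h : ∀ a ∈ s, f (Finsupp.single a 1) = g (Finsupp.single a 1))
    {x : α →₀ ℂ} (hx : x ∈ Finsupp.supported ℂ ℂ s) : f x = g x := by
  have := supported_le_of_single (f := f - g) (N := ⊥) (s := s)
    (fun a ha => by simp [h a ha]) hx
  simpa [sub_eq_zero] using this

/-! ### Chains on tuples -/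

/-- Formal linear combinations of `n`-tuples. -/
abbrev Tup (n : ℕ) (S : Type) : Type := (Fin n → S) →₀ ℂ

/-- The boundary of a chain of tuples. -/
def tupD {n : ℕ} {S : Type} : Tup (n + 1) S →ₗ[ℂ] Tup n S :=
  altSum (fun j v => v ∘ j.succAbove)

/-- The cone with apex `b` on a chain of tuples. -/
def tupCone {n : ℕ} {S : Type} (b : S) : Tup n S →ₗ[ℂ] Tup (n + 1) S :=
  Finsupp.lmapDomain ℂ ℂ (fun v => Fin.cons b v)

/-- The map induced on chains of tuples by a map of sets. -/
def tupMap {n : ℕ} {S S' : Type} (L : S → S') : Tup n S →ₗ[ℂ] Tup n S' :=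
  Finsupp.lmapDomain ℂ ℂ (fun v => L ∘ v)

lemma tupMap_single {n : ℕ} {S S' : Type} (L : S → S') (v : Fin n → S) (c : ℂ) :
    tupMap L (Finsupp.single v c) = Finsupp.single (L ∘ v) c := by
  simp [tupMap, Finsupp.mapDomain_single]

lemma tupCone_single {n : ℕ} {S : Type} (b : S) (v : Fin n → S) (c : ℂ) :
    tupCone b (Finsupp.single v c) = Finsupp.single (Fin.cons b v : Fin (n + 1) → S) c := by
  simp [tupCone, Finsupp.mapDomain_single]

lemma tupMap_tupD {n : ℕ} {S S' : Type} (L : S → S') (x : Tup (n + 1) S) :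
    tupD (tupMap L x) = tupMap L (tupD x) := by
  unfold tupD tupMap
  exact altSum_mapDomain (fun j v => v ∘ j.succAbove) (fun j v => v ∘ j.succAbove)
    (fun v => L ∘ v) (fun v => L ∘ v) (fun _ _ => rfl) x

lemma tupMap_tupCone {n : ℕ} {S S' : Type} (L : S → S') (b : S) (x : Tup n S) :
    tupMap L (tupCone b x) = tupCone (L b) (tupMap L x) := by
  refine finsupp_ext (f := tupMap L ∘ₗ tupCone b) (g := tupCone (L b) ∘ₗ tupMap L) (fun v => ?_) x
  simp only [LinearMap.comp_apply, tupMap_single, tupCone_single]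
  congr 1
  ext i
  refine Fin.cases ?_ (fun j => ?_) i <;> simp

lemma tupD_tupCone {n : ℕ} {S : Type} (b : S) (x : Tup (n + 1) S) :
    tupD (tupCone b x) = x - tupCone b (tupD x) := by
  refine finsupp_ext (f := tupD ∘ₗ tupCone b) (g := LinearMap.id - tupCone b ∘ₗ tupD)
    (fun v => ?_) x
  simp only [LinearMap.comp_apply, LinearMap.sub_apply, LinearMap.id_apply, tupCone_single,
    tupD, altSum_single, map_sum, map_smul]
  rw [Fin.sum_univ_succ, sub_eq_add_neg, ← Finset.sum_neg_distrib]
  congr 1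
  · simp
  · refine Finset.sum_congr rfl (fun j _ => ?_)
    have : (Fin.cons b v : Fin (n + 2) → S) ∘ j.succ.succAbove =
        (Fin.cons b (v ∘ j.succAbove) : Fin (n + 1) → S) := by
      ext i
      refine Fin.cases ?_ (fun k => ?_) i <;> simp
    rw [this, Fin.val_succ, pow_succ]
    simp

lemma tupD_tupCone_zero {S : Type} (b : S) (x : Tup 0 S) : tupD (tupCone b x) = x := by
  refine finsupp_ext (f := tupD ∘ₗ tupCone b) (g := LinearMap.id) (fun v => ?_) x
  simp only [LinearMap.comp_apply, LinearMap.id_apply, tupCone_single, tupD, altSum_single]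
  simp only [Fin.sum_univ_succ]
  simp

lemma tupD_tupD {n : ℕ} {S : Type} (x : Tup (n + 2) S) : tupD (tupD x) = 0 := by
  induction n with
  | zero =>
    refine finsupp_ext (f := tupD ∘ₗ tupD) (g := 0) (fun v => ?_) x
    obtain ⟨b, w, rfl⟩ : ∃ (b : S) (w : Fin 1 → S), v = Fin.cons b w :=
      ⟨v 0, Fin.tail v, (Fin.cons_self_tail v).symm⟩
    simp only [LinearMap.comp_apply, ← tupCone_single, tupD_tupCone, map_sub,
      tupD_tupCone_zero, sub_self, LinearMap.zero_apply]
  | succ n ih =>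
    refine finsupp_ext (f := tupD ∘ₗ tupD) (g := 0) (fun v => ?_) x
    obtain ⟨b, w, rfl⟩ : ∃ (b : S) (w : Fin (n + 2) → S), v = Fin.cons b w :=
      ⟨v 0, Fin.tail v, (Fin.cons_self_tail v).symm⟩
    simp only [LinearMap.comp_apply, ← tupCone_single, tupD_tupCone, map_sub, ih, map_zero,
      sub_zero, sub_self, LinearMap.zero_apply]

/-! ### Barycentric subdivision of tuples -/

section Subdivision

variable {S S' : Type} (bar : ∀ n, (Fin (n + 1) → S) → S) (bar' : ∀ n, (Fin (n + 1) → S') → S')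

/-- Barycentric subdivision of chains of tuples, for a given choice of barycentres. -/
def tupSd : ∀ n, Tup n S →ₗ[ℂ] Tup n S
  | 0 => LinearMap.id
  | n + 1 => Finsupp.linearCombination ℂ
      (fun v => tupCone (bar n v) (tupSd n (tupD (Finsupp.single v 1))))

/-- The chain homotopy between the identity and barycentric subdivision. -/
def tupT : ∀ n, Tup n S →ₗ[ℂ] Tup (n + 1) S
  | 0 => 0
  | n + 1 => Finsupp.linearCombination ℂ
      (fun v => tupCone (bar n v)
        (Finsupp.single v 1 - tupT n (tupD (Finsupp.single v 1))))

lemma tupSd_single (n : ℕ) (v : Fin (n + 1) → S) :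
    tupSd bar (n + 1) (Finsupp.single v 1) =
      tupCone (bar n v) (tupSd bar n (tupD (Finsupp.single v 1))) := by
  simp [tupSd]

lemma tupT_single (n : ℕ) (v : Fin (n + 1) → S) :
    tupT bar (n + 1) (Finsupp.single v 1) =
      tupCone (bar n v) (Finsupp.single v 1 - tupT bar n (tupD (Finsupp.single v 1))) := by
  simp [tupT]

lemma tupD_tupSd (n : ℕ) (x : Tup (n + 1) S) :
    tupD (tupSd bar (n + 1) x) = tupSd bar n (tupD x) := by
  induction n with
  | zero =>
    refine finsupp_ext (f := tupD ∘ₗ tupSd bar 1) (g := tupSd bar 0 ∘ₗ tupD) (fun v => ?_) x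
    simp only [LinearMap.comp_apply, tupSd_single, tupD_tupCone_zero]
  | succ n ih =>
    refine finsupp_ext (f := tupD ∘ₗ tupSd bar (n + 2)) (g := tupSd bar (n + 1) ∘ₗ tupD)
      (fun v => ?_) x
    simp only [LinearMap.comp_apply]
    rw [tupSd_single, tupD_tupCone, ih, tupD_tupD, map_zero, map_zero, sub_zero]

lemma tupD_tupT (n : ℕ) (x : Tup (n + 1) S) :
    tupD (tupT bar (n + 1) x) + tupT bar n (tupD x) = x - tupSd bar (n + 1) x := by
  induction n with
  | zero =>
    refine finsupp_ext (f := tupD ∘ₗ tupT bar 1 + tupT bar 0 ∘ₗ tupD)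
      (g := LinearMap.id - tupSd bar 1) (fun v => ?_) x
    simp only [LinearMap.comp_apply, LinearMap.add_apply, LinearMap.sub_apply, LinearMap.id_apply,
      tupSd_single, tupT_single, tupD_tupCone]
    simp [tupT, tupSd]
  | succ n ih =>
    refine finsupp_ext (f := tupD ∘ₗ tupT bar (n + 2) + tupT bar (n + 1) ∘ₗ tupD)
      (g := LinearMap.id - tupSd bar (n + 2)) (fun v => ?_) x
    simp only [LinearMap.comp_apply, LinearMap.add_apply, LinearMap.sub_apply, LinearMap.id_apply,
      tupSd_single, tupT_single, tupD_tupCone]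
    have := ih (tupD (Finsupp.single v 1))
    rw [tupD_tupD, map_zero, add_zero] at this
    rw [map_sub tupD, this]
    simp only [map_sub]
    abel

variable {bar bar'}

lemma tupMap_tupSd {L : S → S'} (hL : ∀ n v, bar' n (L ∘ v) = L (bar n v)) (n : ℕ) (x : Tup n S) :
    tupMap L (tupSd bar n x) = tupSd bar' n (tupMap L x) := by
  induction n with
  | zero => rfl
  | succ n ih =>
    refine finsupp_ext (f := tupMap L ∘ₗ tupSd bar (n + 1)) (g := tupSd bar' (n + 1) ∘ₗ tupMap L)
      (fun v => ?_) x
    simp only [LinearMap.comp_apply, tupMap_single, tupSd_single, tupMap_tupCone, ih, hL,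
      ← tupMap_tupD]

lemma tupMap_tupT {L : S → S'} (hL : ∀ n v, bar' n (L ∘ v) = L (bar n v)) (n : ℕ) (x : Tup n S) :
    tupMap L (tupT bar n x) = tupT bar' n (tupMap L x) := by
  induction n with
  | zero => simp [tupT]
  | succ n ih =>
    refine finsupp_ext (f := tupMap L ∘ₗ tupT bar (n + 1)) (g := tupT bar' (n + 1) ∘ₗ tupMap L)
      (fun v => ?_) x
    simp only [LinearMap.comp_apply, tupMap_single, tupT_single, tupMap_tupCone, ih, hL,
      ← tupMap_tupD, map_sub]

end Subdivision

section

/-! ### Affine maps between standard simplices -/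

/-- The standard simplex with `n` vertices. -/
abbrev Spl (n : ℕ) : Type := stdSimplex ℝ (Fin n)

/-- The affine map of standard simplices with prescribed images of the vertices. -/
def aff {n m : ℕ} (v : Fin n → Spl m) : C(Spl n, Spl m) where
  toFun x := ⟨fun k => ∑ i, x i * v i k, fun k => Finset.sum_nonneg fun i _ =>
      mul_nonneg (stdSimplex.zero_le x i) (stdSimplex.zero_le (v i) k), by
    rw [Finset.sum_comm]
    simp only [← Finset.mul_sum, stdSimplex.sum_eq_one, mul_one]⟩
  continuous_toFun := by
    refine Continuous.subtype_mk (continuous_pi fun k => continuous_finsetSum _ fun i _ => ?_) _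
    exact ((continuous_apply i).comp continuous_subtype_val).mul continuous_const

lemma aff_apply {n m : ℕ} (v : Fin n → Spl m) (x : Spl n) (k : Fin m) :
    aff v x k = ∑ i, x i * v i k := rfl

lemma aff_coe {n m : ℕ} (v : Fin n → Spl m) (x : Spl n) :
    (aff v x : Fin m → ℝ) = ∑ i, x i • (v i : Fin m → ℝ) := by
  ext k
  simp only [Finset.sum_apply, Pi.smul_apply, smul_eq_mul]
  rfl

lemma aff_comp {n m l : ℕ} (w : Fin m → Spl l) (v : Fin n → Spl m) :
    (aff w).comp (aff v) = aff (aff w ∘ v) := by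
  ext x k
  simp only [ContinuousMap.comp_apply, aff_apply, Function.comp_apply, Finset.sum_mul,
    Finset.mul_sum]
  rw [Finset.sum_comm]
  simp only [mul_assoc]

lemma aff_vertex {n m : ℕ} (v : Fin n → Spl m) (i : Fin n) :
    aff v (stdSimplex.vertex i) = v i := by
  ext k
  rw [aff_apply, Finset.sum_eq_single i]
  · simp
  · intro j _ hj
    simp [Pi.single_eq_of_ne hj]
  · simp

lemma aff_eq_id (m : ℕ) : aff (fun i : Fin m => (stdSimplex.vertex i : Spl m)) =
    ContinuousMap.id (Spl m) := by
  ext x k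
  rw [aff_apply, Finset.sum_eq_single k]
  · simp
  · intro j _ hj
    simp [Pi.single_eq_of_ne' hj]
  · simp

/-- The barycentre of a tuple of points of a simplex. -/
def bar (m n : ℕ) (v : Fin (n + 1) → Spl m) : Spl m := aff v stdSimplex.barycenter

lemma bar_comp {m l n : ℕ} (w : Fin m → Spl l) (v : Fin (n + 1) → Spl m) :
    bar l n (aff w ∘ v) = aff w (bar m n v) := by
  rw [bar, ← aff_comp]
  rfl

lemma aff_mem {n m : ℕ} {K : Set (Fin m → ℝ)} (hK : Convex ℝ K) {v : Fin n → Spl m}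
    (hv : ∀ i, (v i : Fin m → ℝ) ∈ K) (x : Spl n) : (aff v x : Fin m → ℝ) ∈ K := by
  rw [aff_coe]
  exact hK.sum_mem (fun i _ => stdSimplex.zero_le x i) (stdSimplex.sum_eq_one x) (fun i _ => hv i)

/-! ### Singular chains -/

/-- Singular chains with `n` vertices. -/
abbrev Ch (n : ℕ) (Z : Type) [TopologicalSpace Z] : Type := C(Spl n, Z) →₀ ℂ

/-- The inclusion of a face. -/
def face {n : ℕ} (j : Fin (n + 1)) : C(Spl n, Spl (n + 1)) :=
  aff (fun i => stdSimplex.vertex (j.succAbove i))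

variable {Z Z' : Type} [TopologicalSpace Z] [TopologicalSpace Z']

/-- The singular boundary. -/
def dC {n : ℕ} : Ch (n + 1) Z →ₗ[ℂ] Ch n Z := altSum (fun j σ => σ.comp (face j))

lemma dC_single {n : ℕ} (σ : C(Spl (n + 1), Z)) (c : ℂ) :
    dC (Finsupp.single σ c) =
      ∑ j : Fin (n + 1), (-1 : ℂ) ^ (j : ℕ) • Finsupp.single (σ.comp (face j)) c := by
  rw [dC, altSum_single]

/-- The map induced on singular chains. -/
def push {n : ℕ} (f : C(Z, Z')) : Ch n Z →ₗ[ℂ] Ch n Z' :=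
  Finsupp.lmapDomain ℂ ℂ (fun σ => f.comp σ)

lemma push_single {n : ℕ} (f : C(Z, Z')) (σ : C(Spl n, Z)) (c : ℂ) :
    push f (Finsupp.single σ c) = Finsupp.single (f.comp σ) c := lmapDomain_single _ _ _

lemma push_dC {n : ℕ} (f : C(Z, Z')) (x : Ch (n + 1) Z) : dC (push f x) = push f (dC x) := by
  refine finsupp_ext (f := dC ∘ₗ push f) (g := push f ∘ₗ dC) (fun σ => ?_) x
  simp only [LinearMap.comp_apply, push_single, dC_single, map_sum, map_smul,
    ContinuousMap.comp_assoc]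

lemma push_comp {Z'' : Type} [TopologicalSpace Z''] {n : ℕ} (g : C(Z', Z'')) (f : C(Z, Z'))
    (x : Ch n Z) : push g (push f x) = push (g.comp f) x := by
  refine finsupp_ext (f := push g ∘ₗ push f) (g := push (g.comp f)) (fun σ => ?_) x
  simp only [LinearMap.comp_apply, push_single, ContinuousMap.comp_assoc]

lemma push_id {n : ℕ} (x : Ch n Z) : push (ContinuousMap.id Z) x = x := by
  refine finsupp_ext (f := push (ContinuousMap.id Z)) (g := LinearMap.id) (fun σ => ?_) x
  simp only [LinearMap.id_apply, push_single, ContinuousMap.id_comp]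

/-- The singular chain attached to an affine chain in the domain of a singular simplex. -/
def real {m n : ℕ} (σ : C(Spl m, Z)) : Tup n (Spl m) →ₗ[ℂ] Ch n Z :=
  Finsupp.lmapDomain ℂ ℂ (fun v => σ.comp (aff v))

lemma real_single {m n : ℕ} (σ : C(Spl m, Z)) (v : Fin n → Spl m) (c : ℂ) :
    real σ (Finsupp.single v c) = Finsupp.single (σ.comp (aff v)) c := lmapDomain_single _ _ _

lemma dC_real {m n : ℕ} (σ : C(Spl m, Z)) (x : Tup (n + 1) (Spl m)) :
    dC (real σ x) = real σ (tupD x) := by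
  refine finsupp_ext (f := dC ∘ₗ real σ) (g := real σ ∘ₗ tupD) (fun v => ?_) x
  simp only [LinearMap.comp_apply, real_single, dC_single, tupD, altSum_single, map_sum, map_smul]
  refine Finset.sum_congr rfl fun j _ => ?_
  rw [ContinuousMap.comp_assoc, face, aff_comp]
  congr 4
  ext1 i
  simp only [Function.comp_apply, aff_vertex]

/-- The identity affine simplex. -/
def iota (m : ℕ) : Tup m (Spl m) := Finsupp.single (fun i => stdSimplex.vertex i) 1

lemma real_iota {m : ℕ} (σ : C(Spl m, Z)) : real σ (iota m) = Finsupp.single σ 1 := by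
  rw [iota, real_single, aff_eq_id, ContinuousMap.comp_id]

lemma dC_dC {n : ℕ} (x : Ch (n + 2) Z) : dC (dC x) = 0 := by
  refine finsupp_ext (f := dC ∘ₗ dC) (g := 0) (fun σ => ?_) x
  simp only [LinearMap.comp_apply, ← real_iota, dC_real, tupD_tupD, map_zero,
    LinearMap.zero_apply]

lemma tupMap_aff_iota {m l : ℕ} (v : Fin m → Spl l) :
    tupMap (aff v) (iota m) = Finsupp.single v 1 := by
  rw [iota, tupMap_single]
  congr 1
  ext1 i
  simp only [Function.comp_apply, aff_vertex]

lemma real_comp_aff {m l n : ℕ} (σ : C(Spl l, Z)) (v : Fin m → Spl l) (x : Tup n (Spl m)) :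
    real (σ.comp (aff v)) x = real σ (tupMap (aff v) x) := by
  refine finsupp_ext (f := real (σ.comp (aff v))) (g := real σ ∘ₗ tupMap (aff v)) (fun w => ?_) x
  simp only [LinearMap.comp_apply, real_single, tupMap_single, ContinuousMap.comp_assoc, aff_comp]

/-! ### Barycentric subdivision of singular chains -/

/-- Barycentric subdivision. -/
def sd (n : ℕ) : Ch n Z →ₗ[ℂ] Ch n Z :=
  Finsupp.linearCombination ℂ (fun σ => real σ (tupSd (bar n) n (iota n)))

/-- The homotopy between the identity and barycentric subdivision. -/
def sdT (n : ℕ) : Ch n Z →ₗ[ℂ] Ch (n + 1) Z :=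
  Finsupp.linearCombination ℂ (fun σ => real σ (tupT (bar n) n (iota n)))

lemma sd_single {n : ℕ} (σ : C(Spl n, Z)) :
    sd n (Finsupp.single σ 1) = real σ (tupSd (bar n) n (iota n)) := by
  simp [sd]

lemma sdT_single {n : ℕ} (σ : C(Spl n, Z)) :
    sdT n (Finsupp.single σ 1) = real σ (tupT (bar n) n (iota n)) := by
  simp [sdT]

lemma sd_real {m n : ℕ} (σ : C(Spl m, Z)) (x : Tup n (Spl m)) :
    sd n (real σ x) = real σ (tupSd (bar m) n x) := by
  refine finsupp_ext (f := sd n ∘ₗ real σ) (g := real σ ∘ₗ tupSd (bar m) n) (fun v => ?_) x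
  simp only [LinearMap.comp_apply, real_single, sd_single, real_comp_aff]
  rw [tupMap_tupSd (bar' := bar m) (fun _ _ => bar_comp _ _), tupMap_aff_iota]

lemma sdT_real {m n : ℕ} (σ : C(Spl m, Z)) (x : Tup n (Spl m)) :
    sdT n (real σ x) = real σ (tupT (bar m) n x) := by
  refine finsupp_ext (f := sdT n ∘ₗ real σ) (g := real σ ∘ₗ tupT (bar m) n) (fun v => ?_) x
  simp only [LinearMap.comp_apply, real_single, sdT_single, real_comp_aff]
  rw [tupMap_tupT (bar' := bar m) (fun _ _ => bar_comp _ _), tupMap_aff_iota]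

lemma dC_sd {n : ℕ} (x : Ch (n + 1) Z) : dC (sd (n + 1) x) = sd n (dC x) := by
  refine finsupp_ext (f := dC ∘ₗ sd (n + 1)) (g := sd n ∘ₗ dC) (fun σ => ?_) x
  simp only [LinearMap.comp_apply]
  rw [← real_iota, sd_real, dC_real, dC_real, sd_real, tupD_tupSd]

lemma dC_sdT {n : ℕ} (x : Ch (n + 1) Z) :
    dC (sdT (n + 1) x) + sdT n (dC x) = x - sd (n + 1) x := by
  refine finsupp_ext (f := dC ∘ₗ sdT (n + 1) + sdT n ∘ₗ dC) (g := LinearMap.id - sd (n + 1))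
    (fun σ => ?_) x
  simp only [LinearMap.comp_apply, LinearMap.add_apply, LinearMap.sub_apply, LinearMap.id_apply]
  rw [← real_iota, sd_real, dC_real, sdT_real, dC_real, sdT_real, ← map_add, tupD_tupT, map_sub]

/-- The boundaries. -/
def bd (n : ℕ) (Z : Type) [TopologicalSpace Z] : Submodule ℂ (Ch n Z) :=
  LinearMap.range (dC : Ch (n + 1) Z →ₗ[ℂ] Ch n Z)

lemma push_mem_bd {n : ℕ} (f : C(Z, Z')) {x : Ch n Z} (hx : x ∈ bd n Z) :
    push f x ∈ bd n Z' := by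
  obtain ⟨y, rfl⟩ := hx
  exact ⟨push f y, push_dC f y⟩

lemma sd_iterate {n : ℕ} {x : Ch (n + 1) Z} (hx : dC x = 0) (k : ℕ) :
    dC ((sd (n + 1))^[k] x) = 0 ∧ x - (sd (n + 1))^[k] x ∈ bd (n + 1) Z := by
  induction k with
  | zero => simp [hx]
  | succ k ih =>
    rw [Function.iterate_succ_apply']
    refine ⟨by rw [dC_sd, ih.1, map_zero], ?_⟩
    have h := dC_sdT ((sd (n + 1))^[k] x)
    rw [ih.1, map_zero, add_zero] at h
    have : (sd (n + 1))^[k] x - sd (n + 1) ((sd (n + 1))^[k] x) ∈ bd (n + 1) Z := ⟨_, h⟩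
    simpa using add_mem ih.2 this

/-! ### Subdivision makes simplices small -/

lemma tupSd_mem_convex {m : ℕ} {K : Set (Fin m → ℝ)} (hK : Convex ℝ K) (n : ℕ)
    {x : Tup n (Spl m)} (hx : x ∈ Finsupp.supported ℂ ℂ {v | ∀ i, (v i : Fin m → ℝ) ∈ K}) :
    tupSd (bar m) n x ∈ Finsupp.supported ℂ ℂ {v | ∀ i, (v i : Fin m → ℝ) ∈ K} := by
  induction n with
  | zero => exact hx
  | succ n ih =>
    refine supported_le_of_single (fun v hv => ?_) hx
    rw [tupSd_single]
    refine supported_le_of_single (s := {v | ∀ i, (v i : Fin m → ℝ) ∈ K}) (fun w hw => ?_) (ih ?_)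
    · rw [tupCone_single]
      refine Finsupp.single_mem_supported _ _ (fun i => ?_)
      refine Fin.cases ?_ (fun j => ?_) i
      · exact aff_mem hK hv _
      · simpa using hw j
    · rw [tupD, altSum_single]
      refine Submodule.sum_mem _ fun j _ => Submodule.smul_mem _ _ ?_
      exact Finsupp.single_mem_supported _ _ (fun i => hv _)

lemma dist_bar_le {m n : ℕ} {v : Fin (n + 1) → Spl m} {D : ℝ}
    (hv : ∀ i j, dist (v i) (v j) ≤ D) (i : Fin (n + 1)) :
    ((n : ℝ) + 1) * dist (bar m n v) (v i) ≤ n * D := by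
  have hpos : (0 : ℝ) < (n : ℝ) + 1 := by positivity
  have h1 : ((bar m n v : Spl m) : Fin m → ℝ) - v i =
      ((n : ℝ) + 1)⁻¹ • ∑ j, ((v j : Fin m → ℝ) - v i) := by
    rw [bar, aff_coe, Finset.smul_sum]
    have : (v i : Fin m → ℝ) = ∑ j : Fin (n + 1), ((n : ℝ) + 1)⁻¹ • (v i : Fin m → ℝ) := by
      rw [Finset.sum_const, Finset.card_univ, Fintype.card_fin, ← Nat.cast_smul_eq_nsmul ℝ,
        smul_smul]
      push_cast
      rw [mul_inv_cancel₀ hpos.ne', one_smul]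
    conv_lhs => rw [this]
    rw [← Finset.sum_sub_distrib]
    refine Finset.sum_congr rfl fun j _ => ?_
    rw [smul_sub]
    congr 2
    change ((Fintype.card (Fin (n + 1)) : ℝ))⁻¹ = _
    rw [Fintype.card_fin]
    push_cast
    rfl
  have h2 : dist (bar m n v) (v i) = ((n : ℝ) + 1)⁻¹ * ‖∑ j, ((v j : Fin m → ℝ) - v i)‖ := by
    rw [Subtype.dist_eq, dist_eq_norm]
    refine (congrArg norm h1).trans ?_
    rw [norm_smul, Real.norm_of_nonneg (by positivity)]
  rw [h2, mul_inv_cancel_left₀ hpos.ne']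
  rw [Fin.sum_univ_succAbove _ i, sub_self, zero_add]
  refine (norm_sum_le _ _).trans ?_
  refine (Finset.sum_le_card_nsmul _ _ D (fun j _ => ?_)).trans (by simp)
  rw [← dist_eq_norm]
  exact hv _ _

lemma tupSd_mesh {m : ℕ} {q D : ℝ} (hD : 0 ≤ D) (hq : q ≤ 1) (n : ℕ)
    (hn : (n : ℝ) - 1 ≤ q * n) {x : Tup n (Spl m)}
    (hx : x ∈ Finsupp.supported ℂ ℂ {v | ∀ i j, dist (v i) (v j) ≤ D}) :
    tupSd (bar m) n x ∈ Finsupp.supported ℂ ℂ {v | ∀ i j, dist (v i) (v j) ≤ q * D} := by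
  induction n with
  | zero =>
    rw [Finsupp.mem_supported]
    intro v _ i
    exact i.elim0
  | succ n ih =>
    refine supported_le_of_single (fun v hv => ?_) hx
    rw [tupSd_single]
    have hq0 : 0 ≤ q := by
      by_contra h
      push_cast at hn
      have : (0 : ℝ) ≤ n := n.cast_nonneg
      nlinarith
    have hb : ∀ i, dist (bar m n v) (v i) ≤ q * D := by
      intro i
      have h1 := dist_bar_le hv i
      push_cast at hn
      have hpos : (0 : ℝ) < (n : ℝ) + 1 := by positivity
      have h2 : (n : ℝ) * D ≤ (q * (n + 1)) * D := by
        refine mul_le_mul_of_nonneg_right ?_ hD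
        linarith
      have h3 : ((n : ℝ) + 1) * dist (bar m n v) (v i) ≤ ((n : ℝ) + 1) * (q * D) := by linarith
      exact le_of_mul_le_mul_left h3 hpos
    have hsupp : ∀ s : Set (Fin n → Spl m), (∀ j : Fin (n + 1), v ∘ j.succAbove ∈ s) →
        tupD (Finsupp.single v (1 : ℂ)) ∈ Finsupp.supported ℂ ℂ s := by
      intro s hs
      rw [tupD, altSum_single]
      refine Submodule.sum_mem _ fun j _ => Submodule.smul_mem _ _ ?_
      exact Finsupp.single_mem_supported _ _ (hs j)
    have hA := ih (by push_cast at hn ⊢; linarith)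
      (hsupp {v | ∀ i j, dist (v i) (v j) ≤ D} (fun j i i' => hv _ _))
    have hB := tupSd_mem_convex (convex_closedBall ((bar m n v : Spl m) : Fin m → ℝ) (q * D)) n
      (hsupp {w | ∀ i, (w i : Fin m → ℝ) ∈ Metric.closedBall _ _} (fun j i => by
        rw [Metric.mem_closedBall, dist_comm]
        exact hb _))
    refine supported_le_of_single
      (s := {v | ∀ i j, dist (v i) (v j) ≤ q * D} ∩
        {w | ∀ i, (w i : Fin m → ℝ) ∈ Metric.closedBall ((bar m n v : Spl m) : Fin m → ℝ) (q * D)})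
      (fun w hw => ?_) ?_
    · rw [tupCone_single]
      refine Finsupp.single_mem_supported _ _ (fun i j => ?_)
      have h2 : ∀ i, dist (bar m n v) (w i) ≤ q * D := fun i => by
        have := hw.2 i
        rwa [Metric.mem_closedBall, dist_comm] at this
      refine Fin.cases ?_ (fun i => ?_) i <;> refine Fin.cases ?_ (fun j => ?_) j
      · simpa using mul_nonneg hq0 hD
      · simpa using h2 j
      · simpa [dist_comm] using h2 i
      · simpa using hw.1 i j
    · rw [Finsupp.supported_inter]
      exact ⟨hA, hB⟩

lemma dist_aff_le {n m : ℕ} {w : Fin n → Spl m} {D : ℝ} (hw : ∀ i j, dist (w i) (w j) ≤ D)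
    (x y : Spl n) : dist (aff w x) (aff w y) ≤ D := by
  have h1 : ∀ i, dist (aff w y) (w i) ≤ D := fun i =>
    aff_mem (convex_closedBall ((w i : Spl m) : Fin m → ℝ) D) (fun j => hw j i) y
  exact aff_mem (convex_closedBall ((aff w y : Spl m) : Fin m → ℝ) D)
    (fun j => by rw [Metric.mem_closedBall, dist_comm]; exact h1 j) x

/-- Simplices with small image under `p`. -/
def Small {B : Type} [PseudoMetricSpace B] (p : Z → B) (δ : ℝ) (n : ℕ) : Set C(Spl n, Z) :=
  {σ | ∀ x y, dist (p (σ x)) (p (σ y)) < δ}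

lemma sd_iterate_real {m n : ℕ} (σ : C(Spl m, Z)) (x : Tup n (Spl m)) (k : ℕ) :
    (sd n)^[k] (real σ x) = real σ ((tupSd (bar m) n)^[k] x) := by
  induction k generalizing x with
  | zero => rfl
  | succ k ih => rw [Function.iterate_succ_apply, Function.iterate_succ_apply, sd_real, ih]

lemma exists_sd_iterate_small {B : Type} [PseudoMetricSpace B] {p : Z → B} (hp : Continuous p)
    {δ : ℝ} (hδ : 0 < δ) (n : ℕ) (c : Ch n Z) :
    ∃ k₀, ∀ k ≥ k₀, (sd n)^[k] c ∈ Finsupp.supported ℂ ℂ (Small p δ n) := by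
  have hlin : ∀ k (x y : Ch n Z), (sd n)^[k] (x + y) = (sd n)^[k] x + (sd n)^[k] y := by
    intro k x y
    rw [← Module.End.coe_pow, map_add]
  have hsm : ∀ k (a : ℂ) (y : Ch n Z), (sd n)^[k] (a • y) = a • (sd n)^[k] y := by
    intro k x y
    rw [← Module.End.coe_pow, map_smul]
  induction c using Finsupp.induction_linear with
  | zero =>
    refine ⟨0, fun k _ => ?_⟩
    rw [← Module.End.coe_pow, map_zero]
    exact zero_mem _
  | add x y hx hy =>
    obtain ⟨k₁, h₁⟩ := hx
    obtain ⟨k₂, h₂⟩ := hy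
    refine ⟨max k₁ k₂, fun k hk => ?_⟩
    rw [hlin]
    exact add_mem (h₁ k (le_trans (le_max_left _ _) hk)) (h₂ k (le_trans (le_max_right _ _) hk))
  | single σ a =>
    have huc : UniformContinuous (fun x => p (σ x)) :=
      CompactSpace.uniformContinuous_of_continuous (hp.comp σ.continuous)
    obtain ⟨η, hη, hησ⟩ := Metric.uniformContinuous_iff.1 huc δ hδ
    set q : ℝ := n / (n + 1) with hq
    have hpos : (0 : ℝ) < (n : ℝ) + 1 := by positivity
    have hq0 : 0 ≤ q := by positivity
    have hq1 : q < 1 := by rw [hq, div_lt_one hpos]; linarith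
    have hqn : (n : ℝ) - 1 ≤ q * n := by
      rw [hq, div_mul_eq_mul_div, le_div_iff₀ hpos]
      nlinarith
    obtain ⟨k₀, hk₀⟩ := exists_pow_lt_of_lt_one hη hq1
    have hmesh : ∀ k, (tupSd (bar n) n)^[k] (iota n) ∈
        Finsupp.supported ℂ ℂ {v : Fin n → Spl n | ∀ i j, dist (v i) (v j) ≤ q ^ k} := by
      intro k
      induction k with
      | zero =>
        refine Finsupp.single_mem_supported _ _ (fun i j => ?_)
        rw [pow_zero, Subtype.dist_eq]
        refine (dist_pi_le_iff zero_le_one).2 fun l => ?_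
        rw [Real.dist_eq, abs_le]
        have h1 := stdSimplex.zero_le (stdSimplex.vertex (S := ℝ) i) l
        have h2 := stdSimplex.le_one (stdSimplex.vertex (S := ℝ) i) l
        have h3 := stdSimplex.zero_le (stdSimplex.vertex (S := ℝ) j) l
        have h4 := stdSimplex.le_one (stdSimplex.vertex (S := ℝ) j) l
        simp only [stdSimplex.vertex_coe] at h1 h2 h3 h4
        constructor <;> linarith
      | succ k ih =>
        rw [Function.iterate_succ_apply', pow_succ']
        exact tupSd_mesh (by positivity) hq1.le n hqn ih
    refine ⟨k₀, fun k hk => ?_⟩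
    rw [← mul_one a, ← smul_eq_mul, ← Finsupp.smul_single, hsm]
    refine Submodule.smul_mem _ _ ?_
    rw [← real_iota, sd_iterate_real]
    refine supported_le_of_single (fun w hw => ?_) (hmesh k)
    rw [real_single]
    refine Finsupp.single_mem_supported _ _ (fun x y => hησ ?_)
    refine (dist_aff_le hw x y).trans_lt (lt_of_le_of_lt ?_ hk₀)
    exact pow_le_pow_of_le_one hq0 hq1.le hk

/-- Every cycle is homologous to a small one. -/
lemma exists_small_cycle {B : Type} [PseudoMetricSpace B] {p : Z → B} (hp : Continuous p)
    {δ : ℝ} (hδ : 0 < δ) {n : ℕ} {c : Ch (n + 1) Z} (hc : dC c = 0) :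
    ∃ c' ∈ Finsupp.supported ℂ ℂ (Small p δ (n + 1)), dC c' = 0 ∧ c - c' ∈ bd (n + 1) Z := by
  obtain ⟨k, hk⟩ := exists_sd_iterate_small hp hδ (n + 1) c
  exact ⟨_, hk k le_rfl, sd_iterate hc k⟩

end

section

variable {X T B Z : Type} [TopologicalSpace X] [TopologicalSpace T] [TopologicalSpace Z]

/-! ### Cones -/

/-- Continuous maps descend along surjections from compact to Hausdorff spaces. -/
lemma exists_desc {P Q : Type} [TopologicalSpace P] [TopologicalSpace Q] [CompactSpace P]
    [T2Space Q] (κ : C(P, Q)) (hκ : Function.Surjective κ) (h : C(P, T))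
    (hh : ∀ a b, κ a = κ b → h a = h b) : ∃ k : C(Q, T), ∀ a, k (κ a) = h a := by
  have hq : Topology.IsQuotientMap κ := κ.continuous.isClosedMap.isQuotientMap κ.continuous hκ
  refine ⟨hq.lift h (fun a b hab => hh a b hab), fun a => ?_⟩
  exact DFunLike.congr_fun (hq.lift_comp h (fun a b hab => hh a b hab)) a

/-- The map exhibiting a simplex as a cone over its zeroth face. -/
def conePt (n : ℕ) : C(Spl n × unitInterval, Spl (n + 1)) where
  toFun y := ⟨Fin.cons (y.2 : ℝ) (fun k => (1 - (y.2 : ℝ)) * y.1 k), by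
    intro k
    refine Fin.cases ?_ (fun k => ?_) k
    · simpa using y.2.2.1
    · simpa using mul_nonneg (sub_nonneg.2 y.2.2.2) (stdSimplex.zero_le y.1 k), by
    rw [Fin.sum_univ_succ]
    simp only [Fin.cons_zero, Fin.cons_succ, ← Finset.mul_sum, stdSimplex.sum_eq_one]
    ring⟩
  continuous_toFun := by
    refine Continuous.subtype_mk (continuous_pi fun k => ?_) _
    refine Fin.cases ?_ (fun k => ?_) k
    · exact continuous_subtype_val.comp continuous_snd
    · simp only [Fin.cons_succ]
      refine (continuous_const.sub (continuous_subtype_val.comp continuous_snd)).mul ?_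
      exact (continuous_apply k).comp (continuous_subtype_val.comp continuous_fst)

lemma conePt_zero {n : ℕ} (y : Spl n × unitInterval) : conePt n y 0 = y.2 := rfl

lemma conePt_succ {n : ℕ} (y : Spl n × unitInterval) (k : Fin n) :
    conePt n y k.succ = (1 - (y.2 : ℝ)) * y.1 k := rfl

lemma conePt_surjective (n : ℕ) : Function.Surjective (conePt (n + 1)) := by
  intro z
  have hsum := stdSimplex.sum_eq_one z
  rw [Fin.sum_univ_succ] at hsum
  by_cases h : z 0 = 1
  · refine ⟨(stdSimplex.vertex 0, 1), ?_⟩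
    have h0 : ∀ k : Fin (n + 1), z k.succ = 0 := by
      rw [h] at hsum
      have : ∑ k : Fin (n + 1), z k.succ = 0 := by linarith
      rw [Finset.sum_eq_zero_iff_of_nonneg (fun k _ => stdSimplex.zero_le z _)] at this
      exact fun k => this k (Finset.mem_univ k)
    ext k
    refine Fin.cases ?_ (fun k => ?_) k
    · rw [conePt_zero, h]
      rfl
    · rw [conePt_succ, h0]
      simp
  · have h1 : 0 < 1 - z 0 := sub_pos.2 (lt_of_le_of_ne (stdSimplex.le_one z 0) h)
    refine ⟨(⟨fun k => z k.succ / (1 - z 0), fun k => div_nonneg (stdSimplex.zero_le z _) h1.le,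
      ?_⟩, ⟨z 0, stdSimplex.zero_le z 0, stdSimplex.le_one z 0⟩), ?_⟩
    · rw [← Finset.sum_div, div_eq_one_iff_eq h1.ne']
      linarith
    · ext k
      refine Fin.cases ?_ (fun k => ?_) k
      · rfl
      · rw [conePt_succ]
        exact mul_div_cancel₀ _ h1.ne'

lemma face_zero {n : ℕ} (x : Spl n) : face 0 x = conePt n (x, 0) := by
  ext k
  rw [face, aff_apply]
  refine Fin.cases ?_ (fun k => ?_) k
  · rw [conePt_zero]
    simp
  · rw [conePt_succ, Finset.sum_eq_single k]
    · simp
    · intro j _ hj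
      simp [Ne.symm hj]
    · simp

lemma face_succ {n : ℕ} (j : Fin (n + 1)) (x : Spl n) (s : unitInterval) :
    face j.succ (conePt n (x, s)) = conePt (n + 1) (face j x, s) := by
  ext k
  rw [face, aff_apply, Fin.sum_univ_succ]
  refine Fin.cases ?_ (fun k => ?_) k
  · rw [conePt_zero]
    simp [conePt_zero]
  · rw [conePt_succ, conePt_zero, face, aff_apply, Finset.mul_sum]
    simp [conePt_succ, Pi.single_apply]

lemma face_one (x : Spl 1) (y : Spl 1) : face 1 x = conePt 1 (y, 1) := by
  ext k
  rw [face, aff_apply]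
  refine Fin.cases ?_ (fun k => ?_) k
  · rw [conePt_zero]
    simp
  · rw [conePt_succ]
    simp [Pi.single_apply]

/-- Chains supported in a subset. -/
abbrev Car (n : ℕ) (A : Set T) : Submodule ℂ (Ch n T) :=
  Finsupp.supported ℂ ℂ {σ : C(Spl n, T) | ∀ x, σ x ∈ A}

lemma Car_mono {n : ℕ} {A A' : Set T} (h : A ⊆ A') {x : Ch n T} (hx : x ∈ Car n A) :
    x ∈ Car n A' := by
  have : {σ : C(Spl n, T) | ∀ x, σ x ∈ A} ⊆ {σ | ∀ x, σ x ∈ A'} := fun σ hσ y => h (hσ y)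
  exact Finsupp.supported_mono this hx

section Cone

variable {f g : C(X, T)}

lemma exists_coneSpl (H : ContinuousMap.Homotopy f g) (hg : IsLocallyConstant g)
    {n : ℕ} (σ : C(Spl (n + 1), X)) :
    ∃ τ : C(Spl (n + 2), T), ∀ x s, τ (conePt (n + 1) (x, s)) = H (s, σ x) := by
  obtain ⟨k, hk⟩ := exists_desc (conePt (n + 1)) (conePt_surjective n)
    (⟨fun y => H (y.2, σ y.1), by fun_prop⟩ : C(Spl (n + 1) × unitInterval, T)) (by
      rintro ⟨x, s⟩ ⟨y, t⟩ hxy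
      have hs : s = t := by
        ext
        simpa only [conePt_zero] using DFunLike.congr_fun hxy 0
      subst hs
      simp only [ContinuousMap.coe_mk]
      by_cases h : (s : ℝ) = 1
      · have hs : s = 1 := by ext; exact h
        subst hs
        rw [H.apply_one, H.apply_one]
        exact (hg.comp_continuous σ.continuous).apply_eq_of_isPreconnected
          isPreconnected_univ (Set.mem_univ _) (Set.mem_univ _)
      · have : x = y := by
          ext k
          have hk := DFunLike.congr_fun hxy k.succ
          rw [conePt_succ, conePt_succ] at hk
          exact mul_left_cancel₀ (sub_ne_zero.2 (Ne.symm h)) hk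
        rw [this])
  exact ⟨k, fun x s => hk (x, s)⟩

lemma exists_cone (H : ContinuousMap.Homotopy f g) (hg : IsLocallyConstant g)
    : ∃ K : ∀ n, Ch (n + 1) X →ₗ[ℂ] Ch (n + 2) T,
    (∀ n x, dC (K (n + 1) x) = push f x - K n (dC x)) ∧
    (∀ x, dC (K 0 x) = push f x - push g x) ∧
    ∀ A : Set T, (∀ y, H y ∈ A) → ∀ n x, K n x ∈ Car (n + 2) A := by
  choose τ hτ using fun n (σ : C(Spl (n + 1), X)) => exists_coneSpl H hg σ
  let K : ∀ n, Ch (n + 1) X →ₗ[ℂ] Ch (n + 2) T := fun n =>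
    Finsupp.lmapDomain ℂ ℂ (τ n)
  have hK : ∀ n σ c, K n (Finsupp.single σ c) = Finsupp.single (τ n σ) c :=
    fun n σ c => lmapDomain_single _ _ _
  have h0 : ∀ n σ, (τ n σ).comp (face 0) = f.comp σ := by
    intro n σ
    ext x
    rw [ContinuousMap.comp_apply, face_zero, hτ, H.apply_zero]
    rfl
  refine ⟨K, fun n x => ?_, fun x => ?_, fun A hA n x => ?_⟩
  · refine finsupp_ext (f := dC ∘ₗ K (n + 1)) (g := push f - K n ∘ₗ dC) (fun σ => ?_) x
    simp only [LinearMap.comp_apply, LinearMap.sub_apply, hK, dC_single, push_single, map_sum,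
      map_smul]
    rw [Fin.sum_univ_succ, sub_eq_add_neg, ← Finset.sum_neg_distrib]
    congr 1
    · rw [h0]
      simp
    · refine Finset.sum_congr rfl fun j _ => ?_
      have : (τ (n + 1) σ).comp (face j.succ) = τ n (σ.comp (face j)) := by
        ext y
        obtain ⟨⟨x, s⟩, rfl⟩ := conePt_surjective n y
        rw [ContinuousMap.comp_apply, face_succ, hτ, hτ]
        rfl
      rw [this, Fin.val_succ, pow_succ]
      simp
  · refine finsupp_ext (f := dC ∘ₗ K 0) (g := push f - push g) (fun σ => ?_) x
    simp only [LinearMap.comp_apply, LinearMap.sub_apply, hK, dC_single, push_single]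
    rw [Fin.sum_univ_succ, Fin.sum_univ_one, h0]
    have : (τ 0 σ).comp (face (Fin.succ 0)) = g.comp σ := by
      ext y
      rw [ContinuousMap.comp_apply, Fin.succ_zero_eq_one, face_one y y, hτ, H.apply_one]
      rfl
    rw [this]
    simp [sub_eq_add_neg]
  · refine finsupp_mem_of_single (fun σ => ?_) x
    rw [hK]
    refine Finsupp.single_mem_supported _ _ fun y => ?_
    obtain ⟨⟨x, s⟩, rfl⟩ := conePt_surjective n y
    rw [hτ]
    exact hA _

/-- Null-homotopic maps kill cycles of positive degree. -/
lemma push_mem_bd_of_homotopy (H : ContinuousMap.Homotopy f g) (hg : IsLocallyConstant g)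
    {n : ℕ} {z : Ch (n + 2) X} (hz : dC z = 0) :
    push f z ∈ bd (n + 2) T := by
  obtain ⟨K, h, -, -⟩ := exists_cone H hg
  refine ⟨K (n + 1) z, ?_⟩
  rw [h, hz, map_zero, sub_zero]

end Cone

/-! ### Locally contractible maps -/

/-- The inclusion of a subset. -/
abbrev incl (A : Set T) : C(A, T) := ⟨Subtype.val, continuous_subtype_val⟩

lemma exists_push_incl {n : ℕ} {A : Set T} {x : Ch n T} (hx : x ∈ Car n A) :
    ∃ x' : Ch n A, push (incl A) x' = x := by
  have : x ∈ LinearMap.range (push (incl A) : Ch n A →ₗ[ℂ] Ch n T) := by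
    refine supported_le_of_single (f := LinearMap.id) (fun σ hσ => ?_) hx
    refine ⟨Finsupp.single ⟨fun y => ⟨σ y, hσ y⟩, by fun_prop⟩ 1, ?_⟩
    rw [push_single]
    rfl
  exact this

lemma push_incl_injective {n : ℕ} (A : Set T) :
    Function.Injective (push (incl A) : Ch n A →ₗ[ℂ] Ch n T) := by
  refine Finsupp.mapDomain_injective fun σ τ h => ?_
  ext x
  exact DFunLike.congr_fun h x

/-- `f` is locally contractible over the base: small preimages contract to locally constant
maps inside small preimages. -/
def LocContr [TopologicalSpace B] (f : T → B) : Prop :=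
  ∀ b, ∀ U ∈ nhds b, ∃ V ∈ nhds b, ∃ (g : C(f ⁻¹' V, T)) (H : (incl (f ⁻¹' V)).Homotopy g),
    IsLocallyConstant g ∧ ∀ y, f (H y) ∈ U

/-- Small cycles of positive degree bound in small sets. -/
def LocAcyc [PseudoMetricSpace B] (f : T → B) : Prop :=
  ∀ ε > 0, ∃ δ > 0, ∀ b n, ∀ z ∈ Car (n + 2) (f ⁻¹' Metric.ball b δ), dC z = 0 →
    ∃ y ∈ Car (n + 3) (f ⁻¹' Metric.ball b ε), dC y = z

/-- A choice of zero-chains over the points of `Z` varying continuously up to boundaries. -/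
def Lift₀ [PseudoMetricSpace B] (p : Z → B) (f : T → B) (s₀ : Z → Ch 1 T) : Prop :=
  ∀ ε > 0, ∃ δ > 0, ∀ z z', dist (p z) (p z') < δ →
    ∃ y ∈ Car 2 (f ⁻¹' Metric.ball (p z) ε), dC y = s₀ z' - s₀ z

section Lebesgue

variable [PseudoMetricSpace B] [CompactSpace B]

lemma exists_lebesgue {ε : ℝ} (hε : 0 < ε) (V : B → Set B) (hV : ∀ b, V b ∈ nhds b) :
    ∃ δ > 0, ∀ b, ∃ b', Metric.ball b δ ⊆ V b' ∧ Metric.ball b' (ε / 2) ⊆ Metric.ball b ε := by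
  obtain ⟨δ, hδ, h⟩ := lebesgue_number_lemma_of_metric (isCompact_univ (X := B))
    (c := fun b => interior (V b) ∩ Metric.ball b (ε / 2))
    (fun b => isOpen_interior.inter Metric.isOpen_ball)
    (fun b _ => Set.mem_iUnion.2 ⟨b, mem_interior_iff_mem_nhds.2 (hV b),
      Metric.mem_ball_self (by positivity)⟩)
  refine ⟨δ, hδ, fun b => ?_⟩
  obtain ⟨b', hb'⟩ := h b (Set.mem_univ b)
  refine ⟨b', fun x hx => interior_subset (hb' hx).1, fun x hx => ?_⟩
  have h1 := (hb' (Metric.mem_ball_self hδ)).2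
  rw [Metric.mem_ball] at h1 hx ⊢
  have h2 := dist_triangle x b' b
  rw [dist_comm b' b] at h2
  linarith

lemma LocContr.locAcyc {f : T → B} (hf : LocContr f) : LocAcyc f := by
  intro ε hε
  choose V hV g H hg hH using fun b => hf b (Metric.ball b (ε / 2))
    (Metric.ball_mem_nhds b (by positivity))
  obtain ⟨δ, hδ, h⟩ := exists_lebesgue hε V hV
  refine ⟨δ, hδ, fun b n z hz hdz => ?_⟩
  obtain ⟨b', hb', hb''⟩ := h b
  obtain ⟨z', rfl⟩ := exists_push_incl (Car_mono (Set.preimage_mono hb') hz)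
  obtain ⟨K, hK, -, hA⟩ := exists_cone (H b') (hg b')
  refine ⟨K (n + 1) z', hA _ (fun y => hb'' (hH b' y)) _ _, ?_⟩
  rw [hK, push_incl_injective _ ((push_dC _ _).symm.trans (hdz.trans (map_zero _).symm)),
    map_zero, sub_zero]

lemma Lift₀.of_local {Z : Type} {p : Z → B} {f : T → B} {s₀ : Z → Ch 1 T}
    (h : ∀ b, ∀ U ∈ nhds b, ∃ V ∈ nhds b, ∀ z z', p z ∈ V → p z' ∈ V →
      ∃ y ∈ Car 2 (f ⁻¹' U), dC y = s₀ z' - s₀ z) : Lift₀ p f s₀ := by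
  intro ε hε
  choose V hV H using fun b => h b (Metric.ball b (ε / 2))
    (Metric.ball_mem_nhds b (by positivity))
  obtain ⟨δ, hδ, h⟩ := exists_lebesgue hε V hV
  refine ⟨δ, hδ, fun z z' hz => ?_⟩
  obtain ⟨b', hb', hb''⟩ := h (p z)
  obtain ⟨y, hy, hdy⟩ := H b' z z' (hb' (Metric.mem_ball_self hδ))
    (hb' (by rwa [Metric.mem_ball, dist_comm]))
  exact ⟨y, Car_mono (Set.preimage_mono hb'') hy, hdy⟩

end Lebesgue

/-! ### Carried chain maps and chain homotopies -/

section Carried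

variable [PseudoMetricSpace B] {p : Z → B} {f : T → B}

lemma Small.face {δ : ℝ} {n : ℕ} {σ : C(Spl (n + 1), Z)} (hσ : σ ∈ Small p δ (n + 1))
    (j : Fin (n + 1)) : σ.comp (face j) ∈ Small p δ n := fun _ _ => hσ _ _

/-- The submodule of chains lying over the `ε`-ball around a point. -/
abbrev Over (f : T → B) (n : ℕ) (b : B) (ε : ℝ) : Submodule ℂ (Ch n T) :=
  Car n (f ⁻¹' Metric.ball b ε)

lemma Over_mono {n : ℕ} {b b' : B} {ε ε' : ℝ} (h : dist b b' + ε ≤ ε') {x : Ch n T}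
    (hx : x ∈ Over f n b ε) : x ∈ Over f n b' ε' :=
  Car_mono (Set.preimage_mono (Metric.ball_subset_ball' (by rw [add_comm]; exact h))) hx

lemma map_dC_mem_Over {n m : ℕ} {δ ε : ℝ} {b : B}
    (s : Ch (n + 1) Z →ₗ[ℂ] Ch m T) {σ : C(Spl (n + 2), Z)}
    (hs : ∀ j x, s (Finsupp.single (σ.comp (face j)) 1) ∈ Over f m (p (σ (face j x))) ε)
    (hb : ∀ x, dist (p (σ x)) b ≤ δ) :
    s (dC (Finsupp.single σ 1)) ∈ Over f m b (δ + ε) := by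
  rw [dC_single, map_sum]
  refine Submodule.sum_mem _ fun j _ => ?_
  rw [map_smul]
  refine Submodule.smul_mem _ _ (Over_mono ?_ (hs j (stdSimplex.vertex 0)))
  linarith [hb (face j (stdSimplex.vertex 0))]

lemma dC_mem_supported {𝒢 : ∀ n, Set C(Spl n, Z)}
    (h𝒢 : ∀ n, ∀ σ ∈ 𝒢 (n + 1), ∀ j, σ.comp (face j) ∈ 𝒢 n) {n : ℕ} {σ : C(Spl (n + 1), Z)}
    (hσ : σ ∈ 𝒢 (n + 1)) : dC (Finsupp.single σ 1) ∈ Finsupp.supported ℂ ℂ (𝒢 n) := by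
  rw [dC_single]
  exact Submodule.sum_mem _ fun j _ => Submodule.smul_mem _ _
    (Finsupp.single_mem_supported _ _ (h𝒢 n σ hσ j))

/-- The singular zero-chain map induced by an assignment of zero-chains to points. -/
def onPoints (s₀ : Z → Ch 1 T) : Ch 1 Z →ₗ[ℂ] Ch 1 T :=
  Finsupp.linearCombination ℂ (fun σ => s₀ (σ (stdSimplex.vertex 0)))

lemma onPoints_single (s₀ : Z → Ch 1 T) (σ : C(Spl 1, Z)) :
    onPoints s₀ (Finsupp.single σ 1) = s₀ (σ (stdSimplex.vertex 0)) := by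
  simp [onPoints]

theorem exists_carried_chainMap (hf : LocAcyc f) {s₀ : Z → Ch 1 T}
    (hs₀ : ∀ z, s₀ z ∈ Car 1 (f ⁻¹' {p z})) (hl : Lift₀ p f s₀) (N : ℕ) {ε : ℝ} (hε : 0 < ε) :
    ∃ δ > 0, ∃ s : ∀ n, Ch (n + 1) Z →ₗ[ℂ] Ch (n + 1) T, s 0 = onPoints s₀ ∧
      (∀ n ≤ N, ∀ σ ∈ Small p δ (n + 1), ∀ x,
        s n (Finsupp.single σ 1) ∈ Over f (n + 1) (p (σ x)) ε) ∧
      (∀ n < N, ∀ σ ∈ Small p δ (n + 2),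
        dC (s (n + 1) (Finsupp.single σ 1)) = s n (dC (Finsupp.single σ 1))) := by
  induction N generalizing ε with
  | zero =>
    refine ⟨1, one_pos, Function.update (fun _ => 0) 0 (onPoints s₀), by simp, ?_, by simp⟩
    intro n hn σ _ x
    obtain rfl : n = 0 := by omega
    rw [Function.update_self, onPoints_single, Subsingleton.elim x (stdSimplex.vertex 0)]
    refine Car_mono (Set.preimage_mono ?_) (hs₀ _)
    simpa using hε
  | succ N ih =>
    have key : ∃ ε' > 0, ε' ≤ ε ∧ ∃ δ' > 0, δ' ≤ ε / 2 ∧ ∀ δ > 0, δ ≤ δ' →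
        ∀ s : ∀ n, Ch (n + 1) Z →ₗ[ℂ] Ch (n + 1) T, s 0 = onPoints s₀ →
        (∀ n ≤ N, ∀ σ ∈ Small p δ (n + 1), ∀ x,
          s n (Finsupp.single σ 1) ∈ Over f (n + 1) (p (σ x)) ε') →
        (∀ n < N, ∀ σ ∈ Small p δ (n + 2),
          dC (s (n + 1) (Finsupp.single σ 1)) = s n (dC (Finsupp.single σ 1))) →
        ∀ σ ∈ Small p δ (N + 2), ∃ y, (∀ x, y ∈ Over f (N + 2) (p (σ x)) ε) ∧
          dC y = s N (dC (Finsupp.single σ 1)) := by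
      suffices h : ∃ ε' > 0, ε' ≤ ε ∧ ∃ δ' > 0, δ' ≤ ε / 2 ∧ ∀ δ > 0, δ ≤ δ' →
          ∀ s : ∀ n, Ch (n + 1) Z →ₗ[ℂ] Ch (n + 1) T, s 0 = onPoints s₀ →
          (∀ n ≤ N, ∀ σ ∈ Small p δ (n + 1), ∀ x,
            s n (Finsupp.single σ 1) ∈ Over f (n + 1) (p (σ x)) ε') →
          (∀ n < N, ∀ σ ∈ Small p δ (n + 2),
            dC (s (n + 1) (Finsupp.single σ 1)) = s n (dC (Finsupp.single σ 1))) →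
          ∀ σ ∈ Small p δ (N + 2), ∃ x₀, ∃ y ∈ Over f (N + 2) (p (σ x₀)) (ε / 2),
            dC y = s N (dC (Finsupp.single σ 1)) by
        obtain ⟨ε', hε', hle, δ', hδ', hδε, h⟩ := h
        refine ⟨ε', hε', hle, δ', hδ', hδε, fun δ hδ hδδ s h0 h1 h2 σ hσ => ?_⟩
        obtain ⟨x₀, y, hy, hdy⟩ := h δ hδ hδδ s h0 h1 h2 σ hσ
        refine ⟨y, fun x => Over_mono ?_ hy, hdy⟩
        linarith [hσ x₀ x]
      cases N with
      | zero =>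
        obtain ⟨δ', hδ', h⟩ := hl (ε / 2) (by positivity)
        refine ⟨ε, hε, le_rfl, min δ' (ε / 2), by positivity, min_le_right _ _, ?_⟩
        intro δ hδ hδδ s h0 _ _ σ hσ
        obtain ⟨y, hy, hdy⟩ := h (σ (face 1 (stdSimplex.vertex 0)))
          (σ (face 0 (stdSimplex.vertex 0)))
          ((hσ _ _).trans_le (hδδ.trans (min_le_left _ _)))
        refine ⟨_, y, hy, hdy.trans ?_⟩
        rw [h0, dC_single, map_sum, Fin.sum_univ_succ, Fin.sum_univ_one, map_smul, map_smul,
          onPoints_single, onPoints_single]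
        simp [sub_eq_add_neg]
      | succ M =>
        obtain ⟨δ', hδ', h⟩ := hf (ε / 2) (by positivity)
        refine ⟨min ε (δ' / 2), by positivity, min_le_left _ _, min (δ' / 2) (ε / 2),
          by positivity, min_le_right _ _, ?_⟩
        intro δ hδ hδδ s h0 h1 h2 σ hσ
        refine ⟨stdSimplex.vertex 0, h _ M _ (Over_mono ?_ (map_dC_mem_Over (s (M + 1))
          (fun j x => h1 (M + 1) le_rfl _ (Small.face hσ j) x)
            (fun x => (hσ x (stdSimplex.vertex 0)).le))) ?_⟩
        · rw [dist_self, zero_add]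
          linarith [hδδ.trans (min_le_left _ _), min_le_right ε (δ' / 2)]
        · have := eq_of_supported (f := dC ∘ₗ s (M + 1)) (g := s M ∘ₗ dC)
            (h2 M (by omega)) (dC_mem_supported (fun n σ hσ j => Small.face hσ j) hσ)
          simp only [LinearMap.comp_apply] at this
          rw [this, dC_dC, map_zero]
    obtain ⟨ε', hε', hle, δ', hδ', hδε, key⟩ := key
    obtain ⟨δ₁, hδ₁, s, h0, h1, h2⟩ := ih hε'
    set δ := min δ₁ δ' with hδdef
    have hδ : 0 < δ := lt_min hδ₁ hδ'
    have hsub : ∀ n, Small p δ n ⊆ Small p δ₁ n := fun n σ hσ x y =>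
      (hσ x y).trans_le (min_le_left _ _)
    choose y hy hdy using key δ hδ (min_le_right _ _) s h0
      (fun n hn σ hσ => h1 n hn σ (hsub _ hσ)) (fun n hn σ hσ => h2 n hn σ (hsub _ hσ))
    let t : Ch (N + 2) Z →ₗ[ℂ] Ch (N + 2) T := Finsupp.linearCombination ℂ
      (fun σ => if h : σ ∈ Small p δ (N + 2) then y σ h else 0)
    have ht : ∀ σ (h : σ ∈ Small p δ (N + 2)), t (Finsupp.single σ 1) = y σ h := by
      intro σ h
      simp [t, h]
    have hne : ∀ n ≤ N, n ≠ N + 1 := fun n hn => by omega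
    refine ⟨δ, hδ, Function.update s (N + 1) t, ?_, fun n hn σ hσ x => ?_, fun n hn σ hσ => ?_⟩
    · rw [Function.update_of_ne (by omega), h0]
    · rcases Nat.lt_or_ge N n with h | h
      · obtain rfl : n = N + 1 := by omega
        rw [Function.update_self, ht σ hσ]
        exact hy σ hσ x
      · rw [Function.update_of_ne (hne n h)]
        refine Over_mono ?_ (h1 n h σ (hsub _ hσ) x)
        rw [dist_self, zero_add]
        exact hle
    · rw [Function.update_of_ne (hne n (by omega))]
      rcases Nat.lt_or_ge n N with h | h
      · rw [Function.update_of_ne (hne (n + 1) h)]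
        exact h2 n h σ (hsub _ hσ)
      · obtain rfl : n = N := by omega
        rw [Function.update_self, ht σ hσ]
        exact hdy σ hσ

theorem exists_carried_homotopy (hf : LocAcyc f) (N : ℕ) {ε : ℝ} (hε : 0 < ε) :
    ∃ η > 0, ∀ 𝒢 : ∀ n, Set C(Spl n, Z),
      (∀ n, ∀ σ ∈ 𝒢 (n + 1), ∀ j, σ.comp (face j) ∈ 𝒢 n) → (∀ n, 𝒢 n ⊆ Small p η n) →
      ∀ u : ∀ n, Ch (n + 1) Z →ₗ[ℂ] Ch (n + 1) T, (∀ σ, u 0 (Finsupp.single σ 1) = 0) →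
      (∀ n ≤ N, ∀ σ ∈ 𝒢 (n + 1), ∀ x,
        u n (Finsupp.single σ 1) ∈ Over f (n + 1) (p (σ x)) η) →
      (∀ n < N, ∀ σ ∈ 𝒢 (n + 2),
        dC (u (n + 1) (Finsupp.single σ 1)) = u n (dC (Finsupp.single σ 1))) →
      ∃ h : ∀ n, Ch (n + 1) Z →ₗ[ℂ] Ch (n + 2) T,
        (∀ σ, dC (h 0 (Finsupp.single σ 1)) = u 0 (Finsupp.single σ 1)) ∧
        (∀ n ≤ N, ∀ σ ∈ 𝒢 (n + 1), ∀ x,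
          h n (Finsupp.single σ 1) ∈ Over f (n + 2) (p (σ x)) ε) ∧
        (∀ n < N, ∀ σ ∈ 𝒢 (n + 2), dC (h (n + 1) (Finsupp.single σ 1)) +
          h n (dC (Finsupp.single σ 1)) = u (n + 1) (Finsupp.single σ 1)) := by
  induction N generalizing ε with
  | zero =>
    refine ⟨1, one_pos, fun 𝒢 _ _ u hu _ _ => ⟨fun _ => 0, fun σ => ?_, fun n _ σ _ x => ?_,
      fun n hn => by omega⟩⟩
    · rw [hu, LinearMap.zero_apply, map_zero]
    · rw [LinearMap.zero_apply]
      exact zero_mem _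
  | succ N ih =>
    obtain ⟨δ, hδ, hfill⟩ := hf (ε / 2) (by positivity)
    obtain ⟨η', hη', ih⟩ := ih (ε := min ε (δ / 2)) (by positivity)
    set η := min η' (min (δ / 2) (ε / 2)) with hη
    have hηη' : η ≤ η' := min_le_left _ _
    have hηδ : η ≤ δ / 2 := (min_le_right _ _).trans (min_le_left _ _)
    have hηε : η ≤ ε / 2 := (min_le_right _ _).trans (min_le_right _ _)
    refine ⟨η, by positivity, fun 𝒢 h𝒢 hsm u hu0 hu1 hu2 => ?_⟩
    obtain ⟨h, hh0, hh1, hh2⟩ := ih 𝒢 h𝒢 (fun n σ hσ x y => (hsm n hσ x y).trans_le hηη') u hu0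
      (fun n hn σ hσ x => Over_mono (by rw [dist_self, zero_add]; exact hηη')
        (hu1 n (by omega) σ hσ x)) (fun n hn σ hσ => hu2 n (by omega) σ hσ)
    have key : ∀ σ ∈ 𝒢 (N + 2), ∃ y, (∀ x, y ∈ Over f (N + 3) (p (σ x)) ε) ∧
        dC y = u (N + 1) (Finsupp.single σ 1) - h N (dC (Finsupp.single σ 1)) := by
      intro σ hσ
      obtain ⟨y, hy, hdy⟩ := hfill (p (σ (stdSimplex.vertex 0))) N
        (u (N + 1) (Finsupp.single σ 1) - h N (dC (Finsupp.single σ 1))) (sub_mem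
          (Over_mono (by rw [dist_self, zero_add]; linarith) (hu1 (N + 1) le_rfl σ hσ _))
          (Over_mono (by rw [dist_self, zero_add]; linarith [min_le_right ε (δ / 2)])
            (map_dC_mem_Over (h N) (fun j x => hh1 N le_rfl _ (h𝒢 _ σ hσ j) x)
              (fun x => (hsm _ hσ x _).le)))) (by
        rw [map_sub, hu2 N (by omega) σ hσ, sub_eq_zero]
        symm
        cases N with
        | zero =>
          exact finsupp_ext (f := dC ∘ₗ h 0) (g := u 0) hh0 _
        | succ M =>
          have := eq_of_supported (f := dC ∘ₗ h (M + 1) + h M ∘ₗ dC) (g := u (M + 1))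
            (hh2 M (by omega)) (dC_mem_supported h𝒢 hσ)
          simp only [LinearMap.comp_apply, LinearMap.add_apply] at this
          rw [← this, dC_dC, map_zero, add_zero])
      refine ⟨y, fun x => Over_mono ?_ hy, hdy⟩
      linarith [hsm _ hσ (stdSimplex.vertex 0) x]
    choose y hy hdy using key
    let t : Ch (N + 2) Z →ₗ[ℂ] Ch (N + 3) T := Finsupp.linearCombination ℂ
      (fun σ => if h : σ ∈ 𝒢 (N + 2) then y σ h else 0)
    have ht : ∀ σ (h : σ ∈ 𝒢 (N + 2)), t (Finsupp.single σ 1) = y σ h := by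
      intro σ h
      simp [t, h]
    have hne : ∀ n ≤ N, n ≠ N + 1 := fun n hn => by omega
    refine ⟨Function.update h (N + 1) t, fun σ => ?_, fun n hn σ hσ x => ?_, fun n hn σ hσ => ?_⟩
    · rw [Function.update_of_ne (by omega), hh0]
    · rcases Nat.lt_or_ge N n with h | h
      · obtain rfl : n = N + 1 := by omega
        rw [Function.update_self, ht σ hσ]
        exact hy σ hσ x
      · rw [Function.update_of_ne (hne n h)]
        refine Over_mono ?_ (hh1 n h σ hσ x)
        rw [dist_self, zero_add]
        exact min_le_left _ _
    · rw [Function.update_of_ne (hne n (by omega))]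
      rcases Nat.lt_or_ge n N with h | h
      · rw [Function.update_of_ne (hne (n + 1) h)]
        exact hh2 n h σ hσ
      · obtain rfl : n = N := by omega
        rw [Function.update_self, ht σ hσ, hdy σ hσ, sub_add_cancel]

/-- A carried chain map vanishing in degree zero maps small cycles to boundaries. -/
theorem exists_forall_mem_bd (hf : LocAcyc f) (p : Z → B) (N : ℕ) :
    ∃ η > 0, ∀ 𝒢 : ∀ n, Set C(Spl n, Z),
      (∀ n, ∀ σ ∈ 𝒢 (n + 1), ∀ j, σ.comp (face j) ∈ 𝒢 n) → (∀ n, 𝒢 n ⊆ Small p η n) →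
      ∀ u : ∀ n, Ch (n + 1) Z →ₗ[ℂ] Ch (n + 1) T, (∀ σ, u 0 (Finsupp.single σ 1) = 0) →
      (∀ n ≤ N + 1, ∀ σ ∈ 𝒢 (n + 1), ∀ x,
        u n (Finsupp.single σ 1) ∈ Over f (n + 1) (p (σ x)) η) →
      (∀ n < N + 1, ∀ σ ∈ 𝒢 (n + 2),
        dC (u (n + 1) (Finsupp.single σ 1)) = u n (dC (Finsupp.single σ 1))) →
      ∀ c ∈ Finsupp.supported ℂ ℂ (𝒢 (N + 2)), dC c = 0 → u (N + 1) c ∈ bd (N + 2) T := by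
  obtain ⟨η, hη, H⟩ := exists_carried_homotopy (p := p) hf (N + 1) one_pos
  refine ⟨η, hη, fun 𝒢 h𝒢 hsm u hu0 hu1 hu2 c hc hdc => ?_⟩
  obtain ⟨h, -, -, hh⟩ := H 𝒢 h𝒢 hsm u hu0 hu1 hu2
  refine ⟨h (N + 1) c, ?_⟩
  have := eq_of_supported (f := dC ∘ₗ h (N + 1) + h N ∘ₗ dC) (g := u (N + 1))
    (hh N (by omega)) hc
  simpa [hdc] using this

end Carried

end

/-! ### Local contractions -/

section Contr

variable {T B Z : Type} [TopologicalSpace T] [TopologicalSpace B]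

/-- Restriction to a smaller subset of the base. -/
abbrev inclFib (f : T → B) {V V₀ : Set B} (h : V ⊆ V₀) : C(f ⁻¹' V, f ⁻¹' V₀) :=
  ⟨Set.inclusion (Set.preimage_mono h), continuous_inclusion _⟩

/-- A deformation over a closed neighbourhood of `b` preserving the fibre over `b` stays close to
`b` after shrinking the neighbourhood. -/
lemma exists_small_homotopy [CompactSpace T] [T2Space B] (f : C(T, B)) {b : B} {V₀ : Set B}
    (hV₀ : V₀ ∈ nhds b) (hc : IsClosed V₀) {g : C(f ⁻¹' V₀, T)}
    (H : (incl (f ⁻¹' V₀)).Homotopy g) (hH : ∀ y, f y.2 = b → f (H y) = b)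
    {U : Set B} (hU : U ∈ nhds b) :
    ∃ V ∈ nhds b, ∃ hV : V ⊆ V₀, ∃ H' : (incl (f ⁻¹' V)).Homotopy (g.comp (inclFib f hV)),
      ∀ y, f (H' y) ∈ U := by
  have : CompactSpace (f ⁻¹' V₀) :=
    isCompact_iff_compactSpace.1 (hc.preimage f.continuous).isCompact
  set S : Set (unitInterval × f ⁻¹' V₀) := {y | f (H y) ∉ interior U} with hS
  have hSc : IsClosed S := by
    have : Continuous fun y => f (H y) := by fun_prop
    exact isOpen_interior.isClosed_compl.preimage this
  have hN : IsClosed ((fun y : unitInterval × f ⁻¹' V₀ => f y.2) '' S) :=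
    (hSc.isCompact.image (by fun_prop)).isClosed
  set N := (fun y : unitInterval × f ⁻¹' V₀ => f y.2) '' S with hNdef
  have hbN : b ∉ N := by
    rintro ⟨y, hy, hyb⟩
    refine hy ?_
    rw [hH y hyb]
    exact mem_interior_iff_mem_nhds.2 hU
  refine ⟨V₀ ∩ Nᶜ, Filter.inter_mem hV₀ (hN.isOpen_compl.mem_nhds hbN), Set.inter_subset_left,
    H.compContinuousMap (inclFib f Set.inter_subset_left), fun y => ?_⟩
  by_contra hcon
  refine y.2.2.2 ⟨(y.1, inclFib f Set.inter_subset_left y.2), fun h => hcon ?_, rfl⟩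
  exact interior_subset h

/-- Zero-chains with vanishing image at the end of a deformation bound along it. -/
lemma exists_dC_eq {A : Set T} {U : Set T} {g : C(A, T)} (H : (incl A).Homotopy g)
    (hg : IsLocallyConstant g) (hH : ∀ y, H y ∈ U) (x : Ch 1 A) (hx : push g x = 0) :
    ∃ y ∈ Car 2 U, dC y = push (incl A) x := by
  obtain ⟨K, -, hK, hA⟩ := exists_cone H hg
  exact ⟨K 0 x, hA _ hH _ _, by rw [hK, hx, sub_zero]⟩

end Contr

section

/-! ### Spheres and their quotients by coordinate permutations -/

lemma exists_homotopy_sphere {X E : Type} [TopologicalSpace X] [NormedAddCommGroup E]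
    [NormedSpace ℝ E] (f g : C(X, Metric.sphere (0 : E) 1))
    (h : ∀ x, (f x : E) ≠ -(g x : E)) :
    ∃ H : f.Homotopy g, ∀ y, f y.2 = g y.2 → H y = f y.2 := by
  let F : unitInterval × X → E := fun y => (1 - (y.1 : ℝ)) • (f y.2 : E) + (y.1 : ℝ) • (g y.2 : E)
  have hF : Continuous F := by fun_prop
  have h0 : ∀ y, F y ≠ 0 := by
    intro y hy
    have h1 : (1 - (y.1 : ℝ)) • (f y.2 : E) = -((y.1 : ℝ) • (g y.2 : E)) :=
      eq_neg_of_add_eq_zero_left hy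
    have h2 := congrArg norm h1
    rw [norm_neg, norm_smul, norm_smul, norm_eq_of_mem_sphere, norm_eq_of_mem_sphere, mul_one,
      mul_one, Real.norm_of_nonneg (sub_nonneg.2 y.1.2.2), Real.norm_of_nonneg y.1.2.1] at h2
    have h3 : (y.1 : ℝ) = 2⁻¹ := by linarith
    rw [← smul_neg, h3, show (1 - (2 : ℝ)⁻¹) = 2⁻¹ by norm_num] at h1
    exact h y.2 (smul_right_injective E (by norm_num : (2 : ℝ)⁻¹ ≠ 0) h1)
  let G : C(unitInterval × X, Metric.sphere (0 : E) 1) :=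
    ⟨fun y => ⟨(‖F y‖)⁻¹ • F y, by
      rw [mem_sphere_zero_iff_norm, norm_smul, norm_inv, norm_norm,
        inv_mul_cancel₀ (norm_ne_zero_iff.2 (h0 y))]⟩, by
      refine Continuous.subtype_mk ?_ _
      exact (hF.norm.inv₀ fun y => norm_ne_zero_iff.2 (h0 y)).smul hF⟩
  have hG : ∀ y (v : Metric.sphere (0 : E) 1), F y = v → G y = v := by
    intro y v hv
    ext
    change (‖F y‖)⁻¹ • F y = v
    rw [hv, norm_eq_of_mem_sphere, inv_one, one_smul]
  refine ⟨⟨G, fun x => hG _ _ ?_, fun x => hG _ _ ?_⟩, fun y hy => hG _ _ ?_⟩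
  · simp [F]
  · simp [F]
  · simp only [F]
    rw [← hy, ← add_smul, sub_add_cancel, one_smul]

variable {ι : Type} [Fintype ι]

/-- The unit sphere of Euclidean space with coordinates indexed by `ι`. -/
abbrev Sph (ι : Type) [Fintype ι] : Type := Metric.sphere (0 : EuclideanSpace ℝ ι) 1

/-- Permutations of the coordinates act on the sphere. -/
instance : MulAction (Equiv.Perm ι) (Sph ι) where
  smul π v := ⟨LinearIsometryEquiv.piLpCongrLeft 2 ℝ ℝ π (v : EuclideanSpace ℝ ι), by simp⟩
  one_smul v := by
    ext i
    rfl
  mul_smul π ρ v := by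
    ext i
    rfl

lemma perm_smul_apply (π : Equiv.Perm ι) (v : Sph ι) (i : ι) :
    ((π • v : Sph ι) : EuclideanSpace ℝ ι) i = (v : EuclideanSpace ℝ ι) (π⁻¹ i) := rfl

lemma perm_smul_coe (π : Equiv.Perm ι) (v : Sph ι) :
    ((π • v : Sph ι) : EuclideanSpace ℝ ι) =
      LinearIsometryEquiv.piLpCongrLeft 2 ℝ ℝ π (v : EuclideanSpace ℝ ι) := rfl

instance : IsIsometricSMul (Equiv.Perm ι) (Sph ι) where
  isometry_smul π := Isometry.of_dist_eq fun v w => by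
    rw [Subtype.dist_eq, Subtype.dist_eq, perm_smul_coe, perm_smul_coe,
      LinearIsometryEquiv.dist_map]

variable (Γ : Subgroup (Equiv.Perm ι))

instance : IsIsometricSMul Γ (Sph ι) where
  isometry_smul π := isometry_smul (Sph ι) (π : Equiv.Perm ι)

/-- The quotient of the sphere by a group of coordinate permutations. -/
abbrev SphQuot : Type := MulAction.orbitRel.Quotient Γ (Sph ι)

/-- The quotient map. -/
def quotMap : C(Sph ι, SphQuot Γ) := ⟨Quotient.mk _, continuous_quotient_mk'⟩

lemma quotMap_surjective : Function.Surjective (quotMap Γ) := Quotient.mk_surjective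

lemma quotMap_eq_iff {v w : Sph ι} : quotMap Γ v = quotMap Γ w ↔ ∃ γ : Γ, γ • w = v :=
  Quotient.eq

lemma quotMap_smul (γ : Γ) (v : Sph ι) : quotMap Γ (γ • v) = quotMap Γ v :=
  (quotMap_eq_iff Γ).2 ⟨γ, rfl⟩

instance : T2Space (SphQuot Γ) := inferInstance

instance : CompactSpace (SphQuot Γ) := Quotient.compactSpace

instance : SecondCountableTopology (SphQuot Γ) :=
  ContinuousConstSMul.secondCountableTopology

instance : PseudoMetricSpace (SphQuot Γ) :=
  haveI : TopologicalSpace.MetrizableSpace (SphQuot Γ) :=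
    TopologicalSpace.metrizableSpace_of_t3_secondCountable _
  (TopologicalSpace.metrizableSpaceMetric (SphQuot Γ)).toPseudoMetricSpace

lemma isOpenMap_quotMap : IsOpenMap (quotMap Γ) := isOpenMap_quotient_mk'_mul

end

section

variable {ι : Type} [Fintype ι] (Γ : Subgroup (Equiv.Perm ι))

/-- Saturated neighbourhoods of an orbit deform equivariantly onto the orbit. -/
lemma exists_quotMap_homotopy (v₀ : Sph ι) {U : Set (SphQuot Γ)}
    (hU : U ∈ nhds (quotMap Γ v₀)) : ∃ V ∈ nhds (quotMap Γ v₀),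
      ∃ g : C(quotMap Γ ⁻¹' V, Sph ι), ∃ H : (incl (quotMap Γ ⁻¹' V)).Homotopy g,
        IsLocallyConstant g ∧ (∀ y, quotMap Γ (H y) ∈ U) ∧ (∀ x, ∃ γ : Γ, g x = γ • v₀) ∧
        ∀ (γ : Γ) (x x' : quotMap Γ ⁻¹' V), (x' : Sph ι) = γ • (x : Sph ι) → g x' = γ • g x := by
  obtain ⟨κ, hκ, hκ4, hsep⟩ : ∃ κ > 0, κ ≤ 1 / 4 ∧ ∀ γ γ' : Γ,
      dist (γ • v₀) (γ' • v₀) < 4 * κ → γ • v₀ = γ' • v₀ := by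
    let d : Γ → ℝ := fun γ => if γ • v₀ = v₀ then 1 else dist (γ • v₀) v₀
    obtain ⟨γ₀, hγ₀⟩ := Finite.exists_min d
    have hd : 0 < d γ₀ := by
      by_cases h : γ₀ • v₀ = v₀
      · simp [d, h]
      · simp [d, h]
    refine ⟨min (d γ₀ / 4) (1 / 4), by positivity, min_le_right _ _, fun γ γ' h => ?_⟩
    by_contra hne
    have hne' : (γ'⁻¹ * γ) • v₀ ≠ v₀ := by
      rw [mul_smul]
      exact fun h' => hne (eq_inv_smul_iff.1 h'.symm).symm
    have h1 := hγ₀ (γ'⁻¹ * γ)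
    simp only [d, if_neg hne'] at h1
    have h2 : dist ((γ'⁻¹ * γ) • v₀) v₀ = dist (γ • v₀) (γ' • v₀) := by
      rw [← dist_smul γ' ((γ'⁻¹ * γ) • v₀) v₀, smul_smul, mul_inv_cancel_left]
    have h3 := min_le_left (d γ₀ / 4) (1 / 4)
    simp only [d] at h1 h3 h
    linarith
  set V₀ : Set (SphQuot Γ) := quotMap Γ '' Metric.closedBall v₀ κ with hV₀
  have hcl : IsClosed V₀ :=
    (Metric.isClosed_closedBall.isCompact.image (quotMap Γ).continuous).isClosed
  have hnhds : V₀ ∈ nhds (quotMap Γ v₀) :=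
    (isOpenMap_quotMap Γ).image_mem_nhds (Metric.closedBall_mem_nhds v₀ hκ)
  have hex : ∀ x : quotMap Γ ⁻¹' V₀, ∃ γ : Γ, dist (x : Sph ι) (γ • v₀) ≤ κ := by
    rintro ⟨x, y, hy, hyx⟩
    obtain ⟨γ, rfl⟩ := (quotMap_eq_iff Γ).1 hyx.symm
    exact ⟨γ, by rw [dist_smul]; exact hy⟩
  choose γ hγ using hex
  have hc : ∀ x y : quotMap Γ ⁻¹' V₀, dist (x : Sph ι) y < κ → γ x • v₀ = γ y • v₀ := by
    intro x y hxy
    refine hsep _ _ ?_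
    have := dist_triangle4 (γ x • v₀) (x : Sph ι) y (γ y • v₀)
    have h1 := hγ x
    rw [dist_comm] at h1
    linarith [hγ y]
  have hlc : IsLocallyConstant fun x => γ x • v₀ := by
    rw [IsLocallyConstant.iff_eventually_eq]
    intro x
    filter_upwards [Metric.ball_mem_nhds x hκ] with y hy
    exact hc y x hy
  have hfix : ∀ x : quotMap Γ ⁻¹' V₀, quotMap Γ x = quotMap Γ v₀ → γ x • v₀ = x := by
    intro x hx
    obtain ⟨γ', hγ'⟩ := (quotMap_eq_iff Γ).1 hx
    rw [← hγ']
    refine hsep _ _ ?_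
    rw [hγ', dist_comm]
    linarith [hγ x]
  have heq : ∀ (γ' : Γ) (x x' : quotMap Γ ⁻¹' V₀), (x' : Sph ι) = γ' • (x : Sph ι) →
      γ x' • v₀ = γ' • γ x • v₀ := by
    intro γ' x x' h
    rw [smul_smul]
    refine hsep _ _ ?_
    have h1 := dist_triangle (γ x' • v₀) x' ((γ' * γ x) • v₀)
    have h2 : dist (x' : Sph ι) ((γ' * γ x) • v₀) = dist (x : Sph ι) (γ x • v₀) := by
      rw [h, mul_smul, dist_smul]
    have h3 := hγ x'
    rw [dist_comm] at h3
    linarith [hγ x]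
  let g : C(quotMap Γ ⁻¹' V₀, Sph ι) := ⟨fun x => γ x • v₀, hlc.continuous⟩
  obtain ⟨H, hH⟩ := exists_homotopy_sphere (incl (quotMap Γ ⁻¹' V₀)) g (by
    intro x hx
    have h1 : dist ((x : Sph ι) : EuclideanSpace ℝ ι) ((γ x • v₀ : Sph ι) : EuclideanSpace ℝ ι) ≤
        κ :=
      hγ x
    have h2 : ((x : Sph ι) : EuclideanSpace ℝ ι) = -((γ x • v₀ : Sph ι) : EuclideanSpace ℝ ι) := hx
    rw [h2, dist_eq_norm, ← neg_add', norm_neg, ← two_smul ℝ, norm_smul,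
      norm_eq_of_mem_sphere] at h1
    norm_num at h1
    linarith)
  obtain ⟨V, hV, hVV, H', hH'⟩ := exists_small_homotopy (quotMap Γ) hnhds hcl H (by
    intro y hy
    rw [hH y (hfix y.2 hy).symm]
    exact hy) hU
  refine ⟨V, hV, g.comp (inclFib _ hVV), H', hlc.comp_continuous
    (inclFib (quotMap Γ) hVV).continuous, hH',
    fun x => ⟨_, rfl⟩, fun γ' x x' h => heq γ' _ _ h⟩

lemma locContr_quotMap : LocContr (quotMap Γ) := by
  intro b U hU
  obtain ⟨v₀, rfl⟩ := quotMap_surjective Γ b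
  obtain ⟨V, hV, g, H, hg, hH, -⟩ := exists_quotMap_homotopy Γ v₀ hU
  exact ⟨V, hV, g, H, hg, hH⟩

/-- The zero-simplex at a point. -/
def pt {T : Type} [TopologicalSpace T] (t : T) : Ch 1 T :=
  Finsupp.single (ContinuousMap.const _ t) 1

lemma push_pt {T T' : Type} [TopologicalSpace T] [TopologicalSpace T'] (f : C(T, T')) (t : T) :
    push f (pt t) = pt (f t) := by
  rw [pt, push_single]
  rfl

lemma pt_mem_Car {T : Type} [TopologicalSpace T] {A : Set T} {t : T} (h : t ∈ A) :
    pt t ∈ Car 1 A := Finsupp.single_mem_supported _ _ fun _ => h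

/-- The sum of the points of an orbit, with multiplicity. -/
def orbitSum (w : SphQuot Γ) : Ch 1 (Sph ι) :=
  ∑ γ : Γ, pt (γ • Function.surjInv (quotMap_surjective Γ) w)

lemma orbitSum_quotMap (v : Sph ι) : orbitSum Γ (quotMap Γ v) = ∑ γ : Γ, pt (γ • v) := by
  obtain ⟨γ', hγ'⟩ := (quotMap_eq_iff Γ).1
    (Function.surjInv_eq (quotMap_surjective Γ) (quotMap Γ v))
  rw [orbitSum, ← hγ']
  exact Fintype.sum_equiv (Equiv.mulRight γ') _ _ fun γ => by simp [mul_smul]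

lemma orbitSum_mem_Car (w : SphQuot Γ) : orbitSum Γ w ∈ Car 1 (quotMap Γ ⁻¹' {w}) := by
  refine Submodule.sum_mem _ fun γ _ => pt_mem_Car ?_
  rw [Set.mem_preimage, quotMap_smul]
  exact Function.surjInv_eq _ _

lemma push_quotMap_orbitSum (w : SphQuot Γ) :
    push (quotMap Γ) (orbitSum Γ w) = (Fintype.card Γ : ℂ) • pt w := by
  rw [orbitSum, map_sum, Finset.sum_congr rfl (fun γ _ => by
    rw [push_pt, quotMap_smul, Function.surjInv_eq (quotMap_surjective Γ) w]), Finset.sum_const,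
    Finset.card_univ, Nat.cast_smul_eq_nsmul]

/-- The action of a coordinate permutation on the sphere. -/
def permMap (π : Equiv.Perm ι) : C(Sph ι, Sph ι) := ⟨fun v => π • v, continuous_const_smul π⟩

lemma push_smul_orbitSum (γ : Γ) (w : SphQuot Γ) :
    push (permMap (γ : Equiv.Perm ι)) (orbitSum Γ w) =
      orbitSum Γ w := by
  rw [orbitSum, map_sum]
  exact Fintype.sum_equiv (Equiv.mulLeft γ) _ _ fun γ' => by
    rw [push_pt, Equiv.coe_mulLeft, mul_smul]
    rfl

lemma lift₀_orbitSum : Lift₀ id (quotMap Γ) (orbitSum Γ) := by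
  refine Lift₀.of_local fun b U hU => ?_
  obtain ⟨v₀, rfl⟩ := quotMap_surjective Γ b
  obtain ⟨V, hV, g, H, hg, hH, horb, heq⟩ := exists_quotMap_homotopy Γ v₀ hU
  refine ⟨V, hV, fun z z' hz hz' => ?_⟩
  have key : ∀ w ∈ V, ∃ x : Ch 1 (quotMap Γ ⁻¹' V), push (incl _) x = orbitSum Γ w ∧
      push g x = ∑ γ : Γ, pt (γ • v₀) := by
    intro w hw
    obtain ⟨v, rfl⟩ := quotMap_surjective Γ w
    have hv : ∀ γ : Γ, γ • v ∈ quotMap Γ ⁻¹' V := fun γ => by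
      rwa [Set.mem_preimage, quotMap_smul]
    obtain ⟨γ₀, hγ₀⟩ := horb ⟨v, hw⟩
    refine ⟨∑ γ : Γ, pt ⟨γ • v, hv γ⟩, ?_, ?_⟩
    · rw [map_sum, orbitSum_quotMap]
      exact Finset.sum_congr rfl fun γ _ => push_pt _ _
    · rw [map_sum]
      refine Fintype.sum_equiv (Equiv.mulRight γ₀) _ _ fun γ => ?_
      rw [push_pt, heq γ ⟨v, hw⟩ ⟨γ • v, hv γ⟩ rfl, hγ₀, smul_smul]
      rfl
  obtain ⟨x, hx, hgx⟩ := key z hz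
  obtain ⟨x', hx', hgx'⟩ := key z' hz'
  obtain ⟨y, hy, hdy⟩ := exists_dC_eq (U := quotMap Γ ⁻¹' U) H hg hH (x' - x)
    (by rw [map_sub, hgx, hgx', sub_self])
  exact ⟨y, hy, by rw [hdy, map_sub, hx, hx']⟩

end

section

variable {ι : Type} [Fintype ι]

/-- A transposition of coordinates reverses the sign of every homology class of the sphere of
positive degree. -/
lemma add_push_swap_mem_bd {n : ℕ} {α β : ι} (hαβ : α ≠ β) {c : Ch (n + 2) (Sph ι)}
    (hc : dC c = 0) : c + push (permMap (Equiv.swap α β)) c ∈ bd (n + 2) (Sph ι) := by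
  set ρ := permMap (Equiv.swap α β) with hρdef
  have hρ : ∀ (v : Sph ι) i, (ρ v : EuclideanSpace ℝ ι) i =
      (v : EuclideanSpace ℝ ι) (Equiv.swap α β i) := fun v i => by
    rw [hρdef]
    change ((Equiv.swap α β • v : Sph ι) : EuclideanSpace ℝ ι) i = _
    rw [perm_smul_apply, Equiv.swap_inv]
  have hρρ : ∀ v, ρ (ρ v) = v := fun v => by
    ext i
    rw [hρ, hρ, Equiv.swap_apply_self]
  have hcoord : ∀ i, Continuous fun v : Sph ι => (v : EuclideanSpace ℝ ι) i := fun i => by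
    fun_prop
  let F : C(Sph ι, Sph ι) := ⟨fun v => if (v : EuclideanSpace ℝ ι) β ≤ (v : EuclideanSpace ℝ ι) α
    then v else ρ v, by
      refine Continuous.if_le continuous_id ρ.continuous (hcoord β) (hcoord α) fun v hv => ?_
      ext i
      rw [hρ]
      by_cases h : i = α
      · rw [h, Equiv.swap_apply_left]
        exact hv.symm
      · by_cases h' : i = β
        · rw [h', Equiv.swap_apply_right]
          exact hv
        · rw [Equiv.swap_apply_of_ne_of_ne h h']⟩
  have hF : ∀ v, (F v = v ∧ ρ (F v) = ρ v) ∨ (F v = ρ v ∧ ρ (F v) = v) := fun v => by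
    by_cases h : (v : EuclideanSpace ℝ ι) β ≤ (v : EuclideanSpace ℝ ι) α
    · left
      have : F v = v := if_pos h
      rw [this]
      exact ⟨rfl, rfl⟩
    · right
      have : F v = ρ v := if_neg h
      rw [this]
      exact ⟨rfl, hρρ v⟩
  have hFle : ∀ v, (F v : EuclideanSpace ℝ ι) β ≤ (F v : EuclideanSpace ℝ ι) α := fun v => by
    by_cases h : (v : EuclideanSpace ℝ ι) β ≤ (v : EuclideanSpace ℝ ι) α
    · have : F v = v := if_pos h
      rwa [this]
    · have : F v = ρ v := if_neg h
      rw [this, hρ, hρ, Equiv.swap_apply_left, Equiv.swap_apply_right]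
      exact (not_le.1 h).le
  have hFnull : ∀ z : Ch (n + 2) (Sph ι), dC z = 0 → push F z ∈ bd (n + 2) (Sph ι) := by
    intro z hz
    obtain ⟨H, -⟩ := exists_homotopy_sphere F
      (ContinuousMap.const _ (⟨EuclideanSpace.single α 1, by simp⟩ : Sph ι)) (by
        intro v hv
        have h := hFle v
        rw [hv] at h
        simp [hαβ.symm] at h
        linarith)
    exact push_mem_bd_of_homotopy H (IsLocallyConstant.const _) hz
  set p := quotMap (⊤ : Subgroup (Equiv.Perm ι)) with hp
  have hpρ : ∀ v, p (ρ v) = p v := fun v => quotMap_smul ⊤ ⟨Equiv.swap α β, trivial⟩ v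
  have hpF : ∀ v, p (F v) = p v := fun v => by
    rcases hF v with h | h <;> rw [h.1]
    exact hpρ v
  obtain ⟨η, hη, key⟩ := exists_forall_mem_bd (locContr_quotMap ⊤).locAcyc p n
  obtain ⟨c', hc's, hc', hcc'⟩ := exists_small_cycle p.continuous hη hc
  let u : ∀ m, Ch (m + 1) (Sph ι) →ₗ[ℂ] Ch (m + 1) (Sph ι) := fun m =>
    LinearMap.id + push ρ - push F - push (ρ.comp F)
  have hu : ∀ m x, dC (u (m + 1) x) = u m (dC x) := fun m x => by
    simp [u, push_dC]
  have hsmall := key (fun m => Small p η m) (fun m σ hσ j => Small.face hσ j) (fun m => subset_rfl)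
    u (fun σ => by
      have hσ : ∀ f : C(Sph ι, Sph ι), f.comp σ =
          ContinuousMap.const _ (f (σ (stdSimplex.vertex 0))) := fun f => by
        ext x
        rw [Subsingleton.elim x (stdSimplex.vertex 0)]
        rfl
      simp only [u, LinearMap.sub_apply, LinearMap.add_apply, LinearMap.id_apply, push_single]
      rw [hσ, hσ, hσ]
      nth_rewrite 1 [← ContinuousMap.id_comp σ]
      rw [hσ]
      rcases hF (σ (stdSimplex.vertex 0)) with h | h
      · simp only [ContinuousMap.comp_apply, h.1, ContinuousMap.id_apply]
        abel
      · simp only [ContinuousMap.comp_apply, h.1, hρρ, ContinuousMap.id_apply]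
        abel)
    (fun m _ σ hσ x => by
      have hmem : ∀ f : C(Sph ι, Sph ι), (∀ v, p (f v) = p v) →
          push f (Finsupp.single σ 1) ∈ Over p (m + 1) (p (σ x)) η := fun f hf => by
        rw [push_single]
        refine Finsupp.single_mem_supported _ _ fun y => ?_
        rw [Set.mem_preimage, ContinuousMap.comp_apply, hf]
        exact hσ _ _
      have h1 := hmem (ContinuousMap.id _) fun v => rfl
      rw [push_id] at h1
      refine Submodule.sub_mem _ (Submodule.sub_mem _ (Submodule.add_mem _ h1 (hmem ρ hpρ))
        (hmem F hpF)) (hmem _ fun v => ?_)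
      rw [ContinuousMap.comp_apply, hpρ, hpF])
    (fun m _ σ _ => hu m _) c' hc's hc'
  have h1 : push F c' ∈ bd (n + 2) (Sph ι) := hFnull c' hc'
  have h2 : push (ρ.comp F) c' ∈ bd (n + 2) (Sph ι) := by
    rw [← push_comp]
    exact push_mem_bd _ h1
  have h3 : c + push ρ c = u (n + 1) c' + push F c' + push (ρ.comp F) c' +
      ((c - c') + push ρ (c - c')) := by
    simp only [u, LinearMap.sub_apply, LinearMap.add_apply, LinearMap.id_apply, map_sub]
    abel
  rw [h3]
  exact Submodule.add_mem _ (Submodule.add_mem _ (Submodule.add_mem _ hsmall h1) h2)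
    (Submodule.add_mem _ hcc' (push_mem_bd _ hcc'))

end

/-! ### The self-join as a compact metrizable space -/

section Join

variable {X : Type} {r : ℕ}

/-- The weight of the `i`-th vertex. -/
def wt (p : JoinPt X r) (i : Fin r) : ℝ := p.1.1 i

/-- The position of the `i`-th vertex. -/
def ps (p : JoinPt X r) (i : Fin r) : X := p.2 i

lemma wt_nonneg (p : JoinPt X r) (i : Fin r) : 0 ≤ wt p i := p.1.2.1 i

lemma sum_wt (p : JoinPt X r) : ∑ i, wt p i = 1 := p.1.2.2

lemma joinPt_ext {p p' : JoinPt X r} (h : ∀ i, wt p i = wt p' i) (h' : ∀ i, ps p i = ps p' i) :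
    p = p' := Prod.ext (Subtype.ext (funext h)) (funext h')

/-- The total weight at a point. -/
def mass (p : JoinPt X r) (z : X) : ℝ := ∑ i, if ps p i = z then wt p i else 0

lemma sum_wt_mul (p : JoinPt X r) (φ : X → ℝ) {S : Finset X} (hS : ∀ i, wt p i ≠ 0 → ps p i ∈ S) :
    ∑ i, wt p i * φ (ps p i) = ∑ z ∈ S, mass p z * φ z := by
  simp only [mass, Finset.sum_mul]
  rw [Finset.sum_comm]
  refine Finset.sum_congr rfl fun i _ => ?_
  by_cases h : wt p i = 0
  · simp [h]
  · rw [Finset.sum_eq_single_of_mem (ps p i) (hS i h)]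
    · rw [if_pos rfl]
    · intro z _ hz
      rw [if_neg hz.symm, zero_mul]

lemma sum_wt_congr {p p' : JoinPt X r} (h : ∀ z, mass p z = mass p' z) (φ : X → ℝ) :
    ∑ i, wt p i * φ (ps p i) = ∑ i, wt p' i * φ (ps p' i) := by
  have hS : ∀ i, ps p i ∈ Finset.univ.image (ps p) ∪ Finset.univ.image (ps p') := by simp
  have hS' : ∀ i, ps p' i ∈ Finset.univ.image (ps p) ∪ Finset.univ.image (ps p') := by simp
  rw [sum_wt_mul p φ fun i _ => hS i, sum_wt_mul p' φ fun i _ => hS' i]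
  simp only [h]

variable [TopologicalSpace X]

lemma continuous_wt (i : Fin r) : Continuous fun p : JoinPt X r => wt p i := by
  have : Continuous fun p : {t : Fin r → ℝ // (∀ i, 0 ≤ t i) ∧ ∑ i, t i = 1} × (Fin r → X) =>
    p.1.1 i := (continuous_apply i).comp (continuous_subtype_val.comp continuous_fst)
  exact this

lemma continuous_ps (i : Fin r) : Continuous fun p : JoinPt X r => ps p i := by
  have : Continuous fun p : {t : Fin r → ℝ // (∀ i, 0 ≤ t i) ∧ ∑ i, t i = 1} × (Fin r → X) =>
    p.2 i := by fun_prop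
  exact this

lemma continuous_joinPt {Y : Type} [TopologicalSpace Y] {f : Y → JoinPt X r}
    (h : ∀ i, Continuous fun y => wt (f y) i) (h' : ∀ i, Continuous fun y => ps (f y) i) :
    Continuous f := by
  have h1 : Continuous fun y => (f y).1 := Continuous.subtype_mk (continuous_pi h) _
  have h2 : Continuous fun y => (f y).2 := continuous_pi h'
  exact h1.prodMk h2

instance [CompactSpace X] : CompactSpace (JoinPt X r) :=
  haveI : CompactSpace {t : Fin r → ℝ // (∀ i, 0 ≤ t i) ∧ ∑ i, t i = 1} :=
    isCompact_iff_compactSpace.1 (isCompact_stdSimplex ℝ (Fin r))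
  inferInstanceAs (CompactSpace
    ({t : Fin r → ℝ // (∀ i, 0 ≤ t i) ∧ ∑ i, t i = 1} × (Fin r → X)))

/-- The quotient map onto the self-join. -/
def joinMap : C(JoinPt X r, SelfJoin X r) := ⟨Quotient.mk _, continuous_quotient_mk'⟩

lemma joinMap_surjective : Function.Surjective (joinMap : C(JoinPt X r, SelfJoin X r)) :=
  Quotient.mk_surjective

lemma joinMap_eq_iff {p p' : JoinPt X r} :
    joinMap p = joinMap p' ↔ ∀ z, mass p z = mass p' z := Quotient.eq

instance [CompactSpace X] : CompactSpace (SelfJoin X r) := Quotient.compactSpace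

/-- Integration of a test function. -/
def joinIntegral (φ : X → ℝ) (hφ : Continuous φ) : C(SelfJoin X r, ℝ) where
  toFun := Quotient.lift (fun p : JoinPt X r => ∑ i, wt p i * φ (ps p i))
    fun _ _ h => sum_wt_congr h φ
  continuous_toFun := Continuous.quotient_lift (continuous_finsetSum _ fun i _ =>
    (continuous_wt i).mul (hφ.comp (continuous_ps i))) _

end Join

section Metric

variable {X : Type} [MetricSpace X] {r : ℕ}

/-- Integrals of cone-shaped test functions. -/
def coneIntegral : SelfJoin X r → C(X × unitInterval, ℝ) :=
  Quotient.lift (fun p : JoinPt X r => ⟨fun y => ∑ i, wt p i * max 0 ((y.2 : ℝ) -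
    dist (ps p i) y.1), by fun_prop⟩) fun p p' h => by
      ext y
      exact sum_wt_congr h fun x => max 0 ((y.2 : ℝ) - dist x y.1)

lemma coneIntegral_joinMap (p : JoinPt X r) (y : X) (ρ : unitInterval) :
    coneIntegral (joinMap p) (y, ρ) = ∑ i, wt p i * max 0 ((ρ : ℝ) - dist (ps p i) y) := rfl

lemma continuous_coneIntegral : Continuous (coneIntegral : SelfJoin X r → _) := by
  refine Continuous.quotient_lift ?_ _
  have : Continuous fun y : JoinPt X r × (X × unitInterval) =>
      ∑ i, wt y.1 i * max 0 ((y.2.2 : ℝ) - dist (ps y.1 i) y.2.1) := by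
    refine continuous_finsetSum _ fun i _ => ?_
    have h1 := (continuous_wt i).comp (continuous_fst (X := JoinPt X r) (Y := X × unitInterval))
    have h2 := (continuous_ps i).comp (continuous_fst (X := JoinPt X r) (Y := X × unitInterval))
    refine h1.mul (continuous_const.max (Continuous.sub (by fun_prop) (h2.dist (by fun_prop))))
  exact (ContinuousMap.curry ⟨_, this⟩).continuous

lemma coneIntegral_injective : Function.Injective (coneIntegral : SelfJoin X r → _) := by
  intro a b hab
  obtain ⟨p, rfl⟩ := joinMap_surjective a
  obtain ⟨p', rfl⟩ := joinMap_surjective b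
  refine joinMap_eq_iff.2 fun z => ?_
  obtain ⟨ρ, hρ, hρ1, h⟩ : ∃ ρ > 0, ρ ≤ 1 ∧ ∀ x ∈ Set.range (ps p) ∪ Set.range (ps p'),
      x ≠ z → ρ ≤ dist x z := by
    have hfin : (Set.range (ps p) ∪ Set.range (ps p')).Finite :=
      (Set.finite_range _).union (Set.finite_range _)
    generalize Set.range (ps p) ∪ Set.range (ps p') = S at hfin
    induction S, hfin using Set.Finite.induction_on with
    | empty => exact ⟨1, one_pos, le_rfl, by simp⟩
    | @insert a S _ _ ih =>
      obtain ⟨ρ, hρ, hρ1, h⟩ := ih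
      by_cases haz : a = z
      · refine ⟨ρ, hρ, hρ1, fun x hx hxz => ?_⟩
        rcases hx with rfl | hx
        · exact absurd haz hxz
        · exact h x hx hxz
      · refine ⟨min ρ (dist a z), lt_min hρ (dist_pos.2 haz), (min_le_left _ _).trans hρ1,
          fun x hx hxz => ?_⟩
        rcases hx with rfl | hx
        · exact min_le_right _ _
        · exact (min_le_left _ _).trans (h x hx hxz)
  have key : ∀ p₁ : JoinPt X r, (∀ i, ps p₁ i ≠ z → ρ ≤ dist (ps p₁ i) z) →
      coneIntegral (joinMap p₁) (z, ⟨ρ, hρ.le, hρ1⟩) = ρ * mass p₁ z := by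
    intro p₁ h
    rw [coneIntegral_joinMap, mass, Finset.mul_sum]
    refine Finset.sum_congr rfl fun i _ => ?_
    by_cases hi : ps p₁ i = z
    · rw [if_pos hi, hi, dist_self, sub_zero, max_eq_right hρ.le, mul_comm]
    · rw [if_neg hi, max_eq_left (sub_nonpos.2 (h i hi)), mul_zero, mul_zero]
  have h1 := key p fun i => h _ (Or.inl ⟨i, rfl⟩)
  rw [hab, key p' fun i => h _ (Or.inr ⟨i, rfl⟩)] at h1
  exact (mul_left_cancel₀ hρ.ne' h1).symm

lemma isEmbedding_coneIntegral [CompactSpace X] :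
    Topology.IsEmbedding (coneIntegral : SelfJoin X r → _) :=
  (continuous_coneIntegral.isClosedEmbedding coneIntegral_injective).isEmbedding

instance [CompactSpace X] : T2Space (SelfJoin X r) := isEmbedding_coneIntegral.t2Space

instance [CompactSpace X] : PseudoMetricSpace (SelfJoin X r) :=
  (isEmbedding_coneIntegral.comapMetricSpace _).toPseudoMetricSpace

end Metric

section

/-! ### The self-join of the two-sphere as a quotient of a higher sphere -/

lemma sum_sq_sph {ι : Type} [Fintype ι] (v : Sph ι) : ∑ i, (v : EuclideanSpace ℝ ι) i ^ 2 = 1 := by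
  rw [← EuclideanSpace.real_norm_sq_eq, norm_eq_of_mem_sphere, one_pow]

lemma toLp_mem_sph {ι : Type} [Fintype ι] {v : ι → ℝ} (h : ∑ i, v i ^ 2 = 1) :
    WithLp.toLp 2 v ∈ Metric.sphere (0 : EuclideanSpace ℝ ι) 1 := by
  rw [mem_sphere_zero_iff_norm, EuclideanSpace.norm_eq, Real.sqrt_eq_one]
  simpa using h

variable {r : ℕ}

/-- Permutations of the factors act on the coordinates. -/
def prodPerm (r : ℕ) : Equiv.Perm (Fin r) →* Equiv.Perm (Fin r × Fin 3) where
  toFun π := π.prodCongr (Equiv.refl _)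
  map_one' := rfl
  map_mul' _ _ := rfl

/-- The group of permutations of the factors. -/
abbrev factorGroup (r : ℕ) : Subgroup (Equiv.Perm (Fin r × Fin 3)) := (prodPerm r).range

/-- Square roots of the weights times the positions form a point of the sphere. -/
def sphMap : C(JoinPt (Sph (Fin 3)) r, Sph (Fin r × Fin 3)) where
  toFun p := ⟨WithLp.toLp 2 fun y => √(wt p y.1) * (ps p y.1).1 y.2, by
    refine toLp_mem_sph ?_
    rw [Fintype.sum_prod_type]
    simp only [mul_pow, Real.sq_sqrt (wt_nonneg p _), ← Finset.mul_sum, sum_sq_sph, mul_one,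
      sum_wt]⟩
  continuous_toFun := by
    refine Continuous.subtype_mk ?_ _
    refine (PiLp.continuous_toLp 2 _).comp (continuous_pi fun y => ?_)
    refine (Real.continuous_sqrt.comp (continuous_wt y.1)).mul ?_
    have : Continuous fun x : Sph (Fin 3) => (x : EuclideanSpace ℝ (Fin 3)) y.2 := by fun_prop
    exact this.comp (continuous_ps y.1)

lemma sphMap_apply (p : JoinPt (Sph (Fin 3)) r) (i : Fin r) (a : Fin 3) :
    (sphMap p : EuclideanSpace ℝ (Fin r × Fin 3)) (i, a) =
      √(wt p i) * (ps p i).1 a := rfl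

lemma sum_sq_sphMap (p : JoinPt (Sph (Fin 3)) r) (i : Fin r) :
    ∑ a, (sphMap p : EuclideanSpace ℝ (Fin r × Fin 3)) (i, a) ^ 2 = wt p i := by
  simp only [sphMap_apply, mul_pow, Real.sq_sqrt (wt_nonneg p _), ← Finset.mul_sum, sum_sq_sph,
    mul_one]

lemma sphMap_surjective :
    Function.Surjective (sphMap : JoinPt (Sph (Fin 3)) r → Sph (Fin r × Fin 3)) := by
  intro v
  let t : Fin r → ℝ := fun i => ∑ a, (v : EuclideanSpace ℝ (Fin r × Fin 3)) (i, a) ^ 2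
  have ht : ∀ i, 0 ≤ t i := fun i => Finset.sum_nonneg fun a _ => sq_nonneg _
  have ht1 : ∑ i, t i = 1 := by
    rw [← sum_sq_sph v, Fintype.sum_prod_type]
  have hx : ∀ i, ∃ x : Sph (Fin 3), ∀ a,
      √(t i) * (x : EuclideanSpace ℝ (Fin 3)) a =
        (v : EuclideanSpace ℝ (Fin r × Fin 3)) (i, a) := by
    intro i
    by_cases h : t i = 0
    · refine ⟨⟨EuclideanSpace.single 0 1, by simp⟩, fun a => ?_⟩
      rw [h, Real.sqrt_zero, zero_mul]
      have := (Finset.sum_eq_zero_iff_of_nonneg fun a _ => sq_nonneg _).1 h a (Finset.mem_univ a)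
      exact (pow_eq_zero_iff two_ne_zero).1 this |>.symm
    · have hs : √(t i) ≠ 0 := (Real.sqrt_ne_zero (ht i)).2 h
      refine ⟨⟨WithLp.toLp 2 fun a =>
        (v : EuclideanSpace ℝ (Fin r × Fin 3)) (i, a) / √(t i), toLp_mem_sph ?_⟩, fun a => ?_⟩
      · simp only [div_pow, Real.sq_sqrt (ht i), ← Finset.sum_div]
        exact div_self h
      · exact mul_div_cancel₀ _ hs
  choose x hx using hx
  refine ⟨(⟨t, ht, ht1⟩, x), ?_⟩
  ext y
  exact hx y.1 y.2

/-- The map from join points to the quotient of the sphere by permutations of the factors. -/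
def sphQuotMap : C(JoinPt (Sph (Fin 3)) r, SphQuot (factorGroup r)) := (quotMap _).comp sphMap

lemma sphQuotMap_surjective : Function.Surjective (sphQuotMap (r := r)) :=
  (quotMap_surjective _).comp sphMap_surjective

lemma sphQuotMap_eq_iff {p p' : JoinPt (Sph (Fin 3)) r} : sphQuotMap p = sphQuotMap p' ↔
    ∃ π : Equiv.Perm (Fin r), ∀ i, wt p i = wt p' (π i) ∧
      (wt p i ≠ 0 → ps p i = ps p' (π i)) := by
  have hact : ∀ (π : Equiv.Perm (Fin r)) (i : Fin r) (a : Fin 3),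
      ((prodPerm r π⁻¹ • sphMap p' : Sph (Fin r × Fin 3)) :
        EuclideanSpace ℝ (Fin r × Fin 3)) (i, a) =
      (sphMap p' : EuclideanSpace ℝ (Fin r × Fin 3)) (π i, a) := fun π i a => by
    rw [perm_smul_apply, ← map_inv, inv_inv]
    rfl
  constructor
  · intro h
    obtain ⟨⟨_, π, rfl⟩, hγ⟩ := (quotMap_eq_iff _).1 h
    have h1 : ∀ i a, (sphMap p : EuclideanSpace ℝ (Fin r × Fin 3)) (i, a) =
        (sphMap p' : EuclideanSpace ℝ (Fin r × Fin 3)) (π⁻¹ i, a) := fun i a => by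
      rw [← hact, inv_inv, ← hγ]
      rfl
    have h2 : ∀ i, wt p i = wt p' (π⁻¹ i) := fun i => by
      rw [← sum_sq_sphMap, ← sum_sq_sphMap]
      simp only [h1]
    refine ⟨π⁻¹, fun i => ⟨h2 i, fun hi => ?_⟩⟩
    ext a
    have h3 := h1 i a
    rw [sphMap_apply, sphMap_apply, ← h2] at h3
    exact mul_left_cancel₀ ((Real.sqrt_ne_zero (wt_nonneg p i)).2 hi) h3
  · rintro ⟨π, hπ⟩
    refine (quotMap_eq_iff _).2 ⟨⟨prodPerm r π⁻¹, _, rfl⟩, ?_⟩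
    ext ⟨i, a⟩
    change ((prodPerm r π⁻¹ • sphMap p' : Sph (Fin r × Fin 3)) :
        EuclideanSpace ℝ (Fin r × Fin 3)) (i, a) = _
    rw [hact, sphMap_apply, sphMap_apply, ← (hπ i).1]
    by_cases h : wt p i = 0
    · simp [h]
    · rw [(hπ i).2 h]

lemma joinMap_eq_of_sphQuotMap_eq {p p' : JoinPt (Sph (Fin 3)) r}
    (h : sphQuotMap p = sphQuotMap p') : joinMap p = joinMap p' := by
  obtain ⟨π, hπ⟩ := sphQuotMap_eq_iff.1 h
  refine joinMap_eq_iff.2 fun z => ?_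
  refine Fintype.sum_equiv π _ _ fun i => ?_
  by_cases hi : wt p i = 0
  · rw [← (hπ i).1, hi]
    simp
  · rw [(hπ i).1, (hπ i).2 hi]

/-- The map from the quotient sphere to the self-join. -/
def projMap (r : ℕ) : C(SphQuot (factorGroup r), SelfJoin (Sph (Fin 3)) r) :=
  (exists_desc sphQuotMap sphQuotMap_surjective joinMap
    fun _ _ h => joinMap_eq_of_sphQuotMap_eq h).choose

lemma projMap_sphQuotMap (p : JoinPt (Sph (Fin 3)) r) :
    projMap r (sphQuotMap p) = joinMap p :=
  (exists_desc sphQuotMap sphQuotMap_surjective joinMap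
    fun _ _ h => joinMap_eq_of_sphQuotMap_eq h).choose_spec p

lemma projMap_surjective : Function.Surjective (projMap r) := fun z => by
  obtain ⟨p, rfl⟩ := joinMap_surjective z
  exact ⟨_, projMap_sphQuotMap p⟩

/-! ### Deformations of the two-sphere -/

/-- Around finitely many points of the sphere there are bump functions and a deformation of the
sphere which collapses their supports. -/
lemma exists_bump_deformation {ι : Type} [Fintype ι] (J : Finset (Sph ι)) :
    ∃ (χ : Sph ι → C(Sph ι, ℝ)) (ψ : C(unitInterval × Sph ι, Sph ι)),
      (∀ z x, 0 ≤ χ z x) ∧ (∀ z, χ z z = 1) ∧ (∀ z ∈ J, ∀ z' ∈ J, z ≠ z' → χ z z' = 0) ∧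
      (∀ x, ψ (0, x) = x) ∧ (∀ s, ∀ z ∈ J, ψ (s, z) = z) ∧
      ∀ z ∈ J, ∀ x, χ z x ≠ 0 → ψ (1, x) = z := by
  obtain ⟨ε, hε, hε4, hsep⟩ : ∃ ε > 0, ε ≤ 1 / 4 ∧
      ∀ z ∈ J, ∀ z' ∈ J, z ≠ z' → 4 * ε ≤ dist z z' := by
    set S := insert (1 / 4 : ℝ) (((J ×ˢ J).filter fun y => y.1 ≠ y.2).image
      fun y => dist y.1 y.2 / 4) with hS
    have hne : S.Nonempty := Finset.insert_nonempty _ _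
    refine ⟨S.min' hne, ?_, Finset.min'_le _ _ (Finset.mem_insert_self _ _), ?_⟩
    · rw [gt_iff_lt, Finset.lt_min'_iff]
      intro y hy
      rcases Finset.mem_insert.1 hy with rfl | hy
      · norm_num
      · obtain ⟨w, hw, rfl⟩ := Finset.mem_image.1 hy
        have := dist_pos.2 (Finset.mem_filter.1 hw).2
        positivity
    · intro z hz z' hz' hzz'
      have := Finset.min'_le S (dist z z' / 4) (Finset.mem_insert_of_mem (Finset.mem_image.2
        ⟨(z, z'), by simp [hz, hz', hzz'], rfl⟩))
      linarith
  let θ : Sph ι → Sph ι → ℝ := fun z x => max 0 (min 1 (2 - dist x z / ε))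
  have hθ0 : ∀ z x, 2 * ε ≤ dist x z → θ z x = 0 := fun z x h => by
    refine max_eq_left ((min_le_right _ _).trans ?_)
    rw [sub_nonpos, le_div_iff₀ hε]
    exact h
  have hθ1 : ∀ z x, dist x z ≤ ε → θ z x = 1 := fun z x h => by
    have : 1 ≤ 2 - dist x z / ε := by
      have := (div_le_one hε).2 h
      linarith
    simp [θ, min_eq_left this]
  have hθle : ∀ z x, θ z x ≤ 1 := fun z x => max_le zero_le_one (min_le_left _ _)
  have hθnn : ∀ z x, 0 ≤ θ z x := fun z x => le_max_left _ _
  let D : Sph ι → EuclideanSpace ℝ ι := fun x =>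
    ∑ z ∈ J, θ z x • ((z : EuclideanSpace ℝ ι) - x)
  have hD1 : ∀ x, ∀ z ∈ J, dist x z < 2 * ε → D x = θ z x • ((z : EuclideanSpace ℝ ι) - x) := by
    intro x z hz hxz
    refine Finset.sum_eq_single_of_mem z hz fun z' hz' hne => ?_
    rw [hθ0, zero_smul]
    have h1 := hsep z hz z' hz' hne.symm
    have h2 := dist_triangle_left z z' x
    linarith
  have hDle : ∀ x, ‖D x‖ ≤ 2 * ε := by
    intro x
    by_cases h : ∃ z ∈ J, dist x z < 2 * ε
    · obtain ⟨z, hz, hxz⟩ := h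
      rw [hD1 x z hz hxz, norm_smul, Real.norm_of_nonneg (hθnn z x), ← dist_eq_norm,
        ← Subtype.dist_eq, dist_comm]
      nlinarith [hθle z x, hθnn z x, dist_nonneg (x := x) (y := z)]
    · push Not at h
      rw [show D x = 0 from Finset.sum_eq_zero fun z hz => by rw [hθ0 z x (h z hz), zero_smul],
        norm_zero]
      positivity
  have hDc : Continuous D := by
    refine continuous_finsetSum _ fun z _ => ?_
    have : Continuous fun x : Sph ι => (z : EuclideanSpace ℝ ι) - x := by fun_prop
    have hθ : Continuous (θ z) := continuous_const.max (continuous_const.min (by fun_prop))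
    exact hθ.smul this
  have hne : ∀ x : Sph ι, (x : EuclideanSpace ℝ ι) + D x ≠ 0 := fun x h => by
    have h1 := hDle x
    rw [eq_neg_of_add_eq_zero_right h, norm_neg, norm_eq_of_mem_sphere] at h1
    linarith
  let g : C(Sph ι, Sph ι) := ⟨fun x => ⟨(‖(x : EuclideanSpace ℝ ι) + D x‖)⁻¹ •
    ((x : EuclideanSpace ℝ ι) + D x), by
      rw [mem_sphere_zero_iff_norm, norm_smul, norm_inv, norm_norm,
        inv_mul_cancel₀ (norm_ne_zero_iff.2 (hne x))]⟩, by
      refine Continuous.subtype_mk ?_ _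
      have hc : Continuous fun x : Sph ι => (x : EuclideanSpace ℝ ι) + D x := by fun_prop
      exact (hc.norm.inv₀ fun x => norm_ne_zero_iff.2 (hne x)).smul hc⟩
  have hg : ∀ z ∈ J, ∀ x, dist x z ≤ ε → g x = z := by
    intro z hz x hx
    ext1
    change (‖(x : EuclideanSpace ℝ ι) + D x‖)⁻¹ • ((x : EuclideanSpace ℝ ι) + D x) = z
    rw [hD1 x z hz (by linarith), hθ1 z x hx, one_smul, add_sub_cancel, norm_eq_of_mem_sphere,
      inv_one, one_smul]
  obtain ⟨H, hH⟩ := exists_homotopy_sphere (ContinuousMap.id (Sph ι)) g (by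
    intro x hx
    have h1 : (‖(x : EuclideanSpace ℝ ι) + D x‖)⁻¹ • ((x : EuclideanSpace ℝ ι) + D x) =
      -(x : EuclideanSpace ℝ ι) := (neg_eq_iff_eq_neg.2 hx).symm
    rw [inv_smul_eq_iff₀ (norm_ne_zero_iff.2 (hne x))] at h1
    set N := ‖(x : EuclideanSpace ℝ ι) + D x‖ with hN
    have h2 : D x = -((1 + N) • (x : EuclideanSpace ℝ ι)) := by
      rw [add_smul, one_smul, neg_add, ← smul_neg, ← h1]
      abel
    have h3 := hDle x
    rw [h2, norm_neg, norm_smul, norm_eq_of_mem_sphere, mul_one,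
      Real.norm_of_nonneg (by positivity)] at h3
    have : 0 ≤ N := norm_nonneg _
    linarith)
  have hχ : ∀ z x : Sph ι, max 0 (1 - dist x z / ε) ≠ 0 → dist x z ≤ ε := by
    intro z x h
    by_contra hcon
    refine h (max_eq_left ?_)
    rw [sub_nonpos, le_div_iff₀ hε]
    linarith
  refine ⟨fun z => ⟨fun x => max 0 (1 - dist x z / ε), by fun_prop⟩, H.toContinuousMap,
    fun z x => le_max_left _ _, fun z => by simp, fun z hz z' hz' hzz' => ?_, fun x => H.apply_zero x,
    fun s z hz => ?_,
    fun z hz x hx => ?_⟩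
  · by_contra hcon
    have h1 := hχ z z' hcon
    have h2 := hsep z hz z' hz' hzz'
    rw [dist_comm] at h2
    linarith
  · exact hH (s, z) (hg z hz z (by rw [dist_self]; exact hε.le)).symm
  · exact (H.apply_one x).trans (hg z hz x (hχ z x hx))

end

section

/-! ### Contracting neighbourhoods of points of the self-join -/

variable {r : ℕ}

lemma mass_nonneg {X : Type} (p : JoinPt X r) (z : X) : 0 ≤ mass p z :=
  Finset.sum_nonneg fun i _ => by
    split_ifs
    · exact wt_nonneg p i
    · exact le_rfl

lemma mass_ne_zero {X : Type} {p : JoinPt X r} {i : Fin r} (h : wt p i ≠ 0) :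
    mass p (ps p i) ≠ 0 := by
  intro h0
  have := (Finset.sum_eq_zero_iff_of_nonneg fun j _ => by
    split_ifs
    · exact wt_nonneg p j
    · exact le_rfl).1 h0 i (Finset.mem_univ i)
  rw [if_pos rfl] at this
  exact h this

/-- The support of a weighted configuration. -/
def supp {X : Type} (p : JoinPt X r) : Finset X :=
  (Finset.univ.image (ps p)).filter fun z => mass p z ≠ 0

lemma mem_supp {X : Type} {p : JoinPt X r} {z : X} : z ∈ supp p ↔ mass p z ≠ 0 := by
  rw [supp, Finset.mem_filter, and_iff_right_iff_imp]
  intro h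
  obtain ⟨i, -, hi⟩ := Finset.exists_ne_zero_of_sum_ne_zero h
  refine Finset.mem_image.2 ⟨i, Finset.mem_univ i, ?_⟩
  by_contra hcon
  exact hi (if_neg hcon)

lemma sum_supp_mass {X : Type} (p : JoinPt X r) : ∑ z ∈ supp p, mass p z = 1 := by
  have := sum_wt_mul p (fun _ => 1) fun i hi => mem_supp.2 (mass_ne_zero hi)
  simpa [sum_wt] using this.symm

/-- A small closed neighbourhood of a point of the self-join contracts to the point, and the
contraction lifts to the quotient sphere. -/
lemma exists_join_contraction (p₀ : JoinPt (Sph (Fin 3)) r) :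
    ∃ K ∈ nhds (joinMap p₀), IsClosed K ∧
      ∃ HZ : (incl K).Homotopy (ContinuousMap.const _ (joinMap p₀)),
        (∀ y, (y.2 : SelfJoin (Sph (Fin 3)) r) = joinMap p₀ → HZ y = joinMap p₀) ∧
        ∃ (g : C(projMap r ⁻¹' K, SphQuot (factorGroup r)))
          (HW : (incl (projMap r ⁻¹' K)).Homotopy g),
          ∀ y, projMap r (HW y) = HZ (y.1, ⟨projMap r y.2, y.2.2⟩) := by
  set J := supp p₀ with hJ
  set w := mass p₀ with hw
  obtain ⟨χ, ψ, hχ0, hχ1, hχJ, hψ0, hψJ, hψ1⟩ := exists_bump_deformation J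
  let M : Sph (Fin 3) → C(SelfJoin (Sph (Fin 3)) r, ℝ) := fun z => joinIntegral _ (χ z).continuous
  have hM : ∀ z p, M z (joinMap p) = ∑ i, wt p i * χ z (ps p i) := fun z p => rfl
  have hwJ : ∀ z ∈ J, 0 < w z := fun z hz => (mass_nonneg p₀ z).lt_of_ne' (mem_supp.1 hz)
  have hM0 : ∀ z ∈ J, M z (joinMap p₀) = w z := fun z hz => by
    rw [hM, sum_wt_mul p₀ (χ z) fun i hi => mem_supp.2 (mass_ne_zero hi),
      Finset.sum_eq_single_of_mem z hz, hχ1, mul_one]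
    intro z' hz' hne
    rw [hχJ z hz z' hz' hne.symm, mul_zero]
  set K : Set (SelfJoin (Sph (Fin 3)) r) := {μ | ∀ z ∈ J, w z / 2 ≤ M z μ} with hK
  have hKc : IsClosed K := by
    rw [hK]
    simp only [Set.ofPred_forall]
    exact isClosed_biInter fun z _ => isClosed_le continuous_const (M z).continuous
  have hKn : K ∈ nhds (joinMap p₀) := by
    have : ∀ z ∈ J, ∀ᶠ μ in nhds (joinMap p₀), w z / 2 ≤ M z μ := fun z hz => by
      have h1 := (M z).continuous.tendsto (joinMap p₀)
      rw [hM0 z hz] at h1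
      exact (h1.eventually_const_lt (half_lt_self (hwJ z hz))).mono fun _ h => h.le
    exact (Filter.eventually_all_finset J).2 this
  have hMpos : ∀ μ ∈ K, ∀ z ∈ J, 0 < M z μ := fun μ hμ z hz =>
    (half_pos (hwJ z hz)).trans_le (hμ z hz)
  let φ : ℝ → SelfJoin (Sph (Fin 3)) r → Sph (Fin 3) → ℝ := fun s μ x =>
    (1 - s) + s * ∑ z ∈ J, w z * χ z x / M z μ
  have hφ0 : ∀ s : unitInterval, ∀ μ ∈ K, ∀ x, 0 ≤ φ s μ x := fun s μ hμ x => by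
    refine add_nonneg (sub_nonneg.2 s.2.2) (mul_nonneg s.2.1 (Finset.sum_nonneg fun z hz => ?_))
    exact div_nonneg (mul_nonneg (hwJ z hz).le (hχ0 z x)) (hMpos μ hμ z hz).le
  have hφ1 : ∀ s, ∀ p : JoinPt (Sph (Fin 3)) r, joinMap p ∈ K →
      ∑ i, wt p i * φ s (joinMap p) (ps p i) = 1 := fun s p hp => by
    simp only [φ, mul_add, Finset.sum_add_distrib, ← Finset.sum_mul, sum_wt]
    have h1 : ∑ i, wt p i * (s * ∑ z ∈ J, w z * χ z (ps p i) / M z (joinMap p)) =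
        s * ∑ z ∈ J, w z / M z (joinMap p) * M z (joinMap p) := by
      simp only [Finset.mul_sum]
      rw [Finset.sum_comm]
      refine Finset.sum_congr rfl fun z _ => ?_
      have : ∑ i, wt p i * (s * (w z * χ z (ps p i) / M z (joinMap p))) =
          s * (w z / M z (joinMap p) * ∑ i, wt p i * χ z (ps p i)) := by
        simp only [Finset.mul_sum]
        refine Finset.sum_congr rfl fun i _ => ?_
        ring
      rw [this, ← hM z p]
    rw [h1, Finset.sum_congr rfl fun z hz => div_mul_cancel₀ (w z) (hMpos _ hp z hz).ne',
      hw, sum_supp_mass]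
    ring
  let h : C(unitInterval × (joinMap ⁻¹' K : Set (JoinPt (Sph (Fin 3)) r)),
      JoinPt (Sph (Fin 3)) r) :=
    ⟨fun y => (⟨fun i => wt y.2.1 i * φ y.1 (joinMap y.2.1) (ps y.2.1 i),
      fun i => mul_nonneg (wt_nonneg _ _) (hφ0 _ _ y.2.2 _), hφ1 _ _ y.2.2⟩,
      fun i => ψ (y.1, ps y.2.1 i)), by
      have hc : Continuous fun y : unitInterval ×
          (joinMap ⁻¹' K : Set (JoinPt (Sph (Fin 3)) r)) => y.2.1 :=
        continuous_subtype_val.comp continuous_snd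
      refine continuous_joinPt (fun i => ((continuous_wt i).comp hc).mul ?_)
        (fun i => ψ.continuous.comp (continuous_fst.prodMk ((continuous_ps i).comp hc)))
      have hs : Continuous fun y : unitInterval ×
          (joinMap ⁻¹' K : Set (JoinPt (Sph (Fin 3)) r)) => (y.1 : ℝ) :=
        continuous_subtype_val.comp continuous_fst
      refine (continuous_const.sub hs).add (hs.mul (continuous_finsetSum _ fun z hz => ?_))
      exact (continuous_const.mul ((χ z).continuous.comp ((continuous_ps i).comp hc))).div
        ((M z).continuous.comp (joinMap.continuous.comp hc))
        fun y => (hMpos _ y.2.2 z hz).ne'⟩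
  have hwt : ∀ y i, wt (h y) i = wt y.2.1 i * φ y.1 (joinMap y.2.1) (ps y.2.1 i) :=
    fun _ _ => rfl
  have hps : ∀ y i, ps (h y) i = ψ (y.1, ps y.2.1 i) := fun _ _ => rfl
  have hmass : ∀ y z, mass (h y) z = ∑ i, wt y.2.1 i *
      (if ψ (y.1, ps y.2.1 i) = z then φ y.1 (joinMap y.2.1) (ps y.2.1 i) else 0) := fun y z => by
    simp only [mass, hwt, hps, mul_ite, mul_zero]
  have h_zero : ∀ p, h (0, p) = p := fun p => by
    refine joinPt_ext (fun i => ?_) (fun i => ?_)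
    · rw [hwt]
      simp [φ]
    · rw [hps]
      exact hψ0 _
  have h_one : ∀ p, joinMap (h (1, p)) = joinMap p₀ := fun p => by
    refine joinMap_eq_iff.2 fun z' => ?_
    have h1 : ∀ x, (if ψ (1, x) = z' then φ 1 (joinMap p.1) x else 0) =
        ∑ z ∈ J, if z = z' then w z * χ z x / M z (joinMap p.1) else 0 := by
      intro x
      have h2 : φ 1 (joinMap p.1) x = ∑ z ∈ J, w z * χ z x / M z (joinMap p.1) := by
        simp only [φ, sub_self, zero_add, one_mul]
      rw [h2]
      by_cases hx : ψ (1, x) = z'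
      · rw [if_pos hx]
        refine Finset.sum_congr rfl fun z hz => ?_
        by_cases hzz : χ z x = 0
        · simp [hzz]
        · rw [if_pos ((hψ1 z hz x hzz).symm.trans hx)]
      · rw [if_neg hx]
        refine (Finset.sum_eq_zero fun z hz => ?_).symm
        by_cases hzz : χ z x = 0
        · simp [hzz]
        · rw [if_neg fun hcon => hx ((hψ1 z hz x hzz).trans hcon)]
    rw [hmass]
    simp only [Set.Icc.coe_one, h1, Finset.sum_ite_eq']
    by_cases hz : z' ∈ J
    · simp only [if_pos hz]
      rw [← div_mul_cancel₀ (mass p₀ z') (hMpos _ p.2 z' hz).ne', hM z' p.1, Finset.mul_sum]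
      refine Finset.sum_congr rfl fun i _ => ?_
      rw [← hM z' p.1]
      ring
    · simp only [if_neg hz, mul_zero, Finset.sum_const_zero]
      by_contra hcon
      exact hz (mem_supp.2 (Ne.symm hcon))
  have h_fix : ∀ y, joinMap y.2.1 = joinMap p₀ → joinMap (h y) = joinMap p₀ := fun y hy => by
    rw [← hy]
    refine joinMap_eq_iff.2 fun z => ?_
    refine Finset.sum_congr rfl fun i _ => ?_
    by_cases hi : wt y.2.1 i = 0
    · simp [hwt, hi]
    · have hz : ps y.2.1 i ∈ J := by
        have := mass_ne_zero hi
        rw [joinMap_eq_iff.1 hy] at this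
        exact mem_supp.2 this
      have h2 : φ y.1 (joinMap y.2.1) (ps y.2.1 i) = 1 := by
        simp only [φ]
        rw [Finset.sum_eq_single_of_mem _ hz, hχ1, hy, hM0 _ hz, mul_one,
          div_self (hwJ _ hz).ne']
        · ring
        · intro z' hz' hne
          rw [hχJ z' hz' _ hz hne, mul_zero, zero_div]
      rw [hwt, hps, hψJ _ _ hz, h2, mul_one]
  have h_join : ∀ s (p p' : (joinMap ⁻¹' K : Set (JoinPt (Sph (Fin 3)) r))),
      joinMap p.1 = joinMap p'.1 → joinMap (h (s, p)) = joinMap (h (s, p')) := fun s p p' hp => by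
    refine joinMap_eq_iff.2 fun z => ?_
    rw [hmass, hmass, hp]
    exact sum_wt_congr (joinMap_eq_iff.1 hp)
      fun x => if ψ (s, x) = z then φ s (joinMap p'.1) x else 0
  have h_quot : ∀ s (p p' : (joinMap ⁻¹' K : Set (JoinPt (Sph (Fin 3)) r))),
      sphQuotMap p.1 = sphQuotMap p'.1 → sphQuotMap (h (s, p)) = sphQuotMap (h (s, p')) :=
    fun s p p' hp => by
      have hp' := joinMap_eq_of_sphQuotMap_eq hp
      obtain ⟨π, hπ⟩ := sphQuotMap_eq_iff.1 hp
      refine sphQuotMap_eq_iff.2 ⟨π, fun i => ?_⟩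
      rw [hwt, hwt, hps, hps, hp', ← (hπ i).1]
      by_cases hi : wt p.1 i = 0
      · simp [hi]
      · rw [(hπ i).2 hi]
        exact ⟨rfl, fun _ => rfl⟩
  have hPK : CompactSpace (joinMap ⁻¹' K : Set (JoinPt (Sph (Fin 3)) r)) :=
    isCompact_iff_compactSpace.1 (hKc.preimage joinMap.continuous).isCompact
  obtain ⟨HZ, hHZ⟩ := exists_desc
    (⟨fun y => (y.1, ⟨joinMap y.2.1, y.2.2⟩), by fun_prop⟩ :
      C(unitInterval × (joinMap ⁻¹' K : Set (JoinPt (Sph (Fin 3)) r)), unitInterval × K)) (by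
      rintro ⟨s, μ, hμ⟩
      obtain ⟨p, rfl⟩ := joinMap_surjective μ
      exact ⟨(s, ⟨p, hμ⟩), rfl⟩) (joinMap.comp h) (by
      rintro ⟨s, p⟩ ⟨s', p'⟩ hpp
      obtain ⟨rfl, h2⟩ := Prod.mk.inj hpp
      exact h_join _ _ _ (congrArg Subtype.val h2))
  have hmem : ∀ p : (joinMap ⁻¹' K : Set (JoinPt (Sph (Fin 3)) r)),
      sphQuotMap p.1 ∈ projMap r ⁻¹' K := fun p => by
    rw [Set.mem_preimage, projMap_sphQuotMap]
    exact p.2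
  obtain ⟨HW, hHW⟩ := exists_desc
    (⟨fun y => (y.1, ⟨sphQuotMap y.2.1, hmem y.2⟩), by fun_prop⟩ :
      C(unitInterval × (joinMap ⁻¹' K : Set (JoinPt (Sph (Fin 3)) r)),
        unitInterval × (projMap r ⁻¹' K))) (by
      rintro ⟨s, μ, hμ⟩
      obtain ⟨p, rfl⟩ := sphQuotMap_surjective μ
      rw [Set.mem_preimage, projMap_sphQuotMap] at hμ
      exact ⟨(s, ⟨p, hμ⟩), rfl⟩) (sphQuotMap.comp h) (by
      rintro ⟨s, p⟩ ⟨s', p'⟩ hpp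
      obtain ⟨rfl, h2⟩ := Prod.mk.inj hpp
      exact h_quot _ _ _ (congrArg Subtype.val h2))
  refine ⟨K, hKn, hKc, ⟨HZ, ?_, ?_⟩, ?_, HW.comp ⟨fun x => (1, x), by fun_prop⟩, ⟨HW, ?_, ?_⟩, ?_⟩
  · rintro ⟨μ, hμ⟩
    obtain ⟨p, rfl⟩ := joinMap_surjective μ
    exact (hHZ (0, ⟨p, hμ⟩)).trans (congrArg joinMap (h_zero ⟨p, hμ⟩))
  · rintro ⟨μ, hμ⟩
    obtain ⟨p, rfl⟩ := joinMap_surjective μ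
    exact (hHZ (1, ⟨p, hμ⟩)).trans (h_one ⟨p, hμ⟩)
  · rintro ⟨s, μ, hμ⟩ hy
    obtain ⟨p, rfl⟩ := joinMap_surjective μ
    exact (hHZ (s, ⟨p, hμ⟩)).trans (h_fix (s, ⟨p, hμ⟩) hy)
  · rintro ⟨μ, hμ⟩
    obtain ⟨p, rfl⟩ := sphQuotMap_surjective μ
    have hμ' : joinMap p ∈ K := by
      rwa [Set.mem_preimage, projMap_sphQuotMap] at hμ
    exact (hHW (0, ⟨p, hμ'⟩)).trans (congrArg sphQuotMap (h_zero ⟨p, hμ'⟩))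
  · intro x
    rfl
  · rintro ⟨s, μ, hμ⟩
    obtain ⟨p, rfl⟩ := sphQuotMap_surjective μ
    have hμ' : joinMap p ∈ K := by
      rwa [Set.mem_preimage, projMap_sphQuotMap] at hμ
    refine (congrArg (projMap r) (hHW (s, ⟨p, hμ'⟩))).trans ((projMap_sphQuotMap _).trans ?_)
    refine (hHZ (s, ⟨p, hμ'⟩)).symm.trans (congrArg HZ (Prod.ext rfl (Subtype.ext ?_)))
    exact (projMap_sphQuotMap p).symm

end

section

/-! ### Contracting the fibres of the projection to the self-join -/

section Gather

variable {r : ℕ} {X : Type}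

/-- The vertices `a j` sit at the points `j` of the support and have maximal weights there. -/
def IsPeak {p₀ : JoinPt X r} (a : supp p₀ → Fin r) (p : JoinPt X r) : Prop :=
  ∀ j, ps p (a j) = j ∧ wt p (a j) ≠ 0 ∧ ∀ i, ps p i = j → wt p i ≤ wt p (a j)

/-- The weights obtained by moving mass towards the vertices `a j`. -/
def gatherWt {p₀ : JoinPt X r} (a : supp p₀ → Fin r) (s : ℝ) (p : JoinPt X r) (i : Fin r) : ℝ :=
  (1 - s) * wt p i + s * ∑ j, if a j = i then mass p₀ j else 0

lemma IsPeak.sum_eq_zero {p₀ p : JoinPt X r} {a : supp p₀ → Fin r} (h : IsPeak a p)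
    {i : Fin r} (hi : wt p i = 0) :
    ∑ j, (if a j = i then mass p₀ j else 0) = 0 :=
  Finset.sum_eq_zero fun j _ => if_neg fun hj : a j = i => (h j).2.1 (hj ▸ hi)

variable [TopologicalSpace X]

/-- Moving all the mass to the vertices `a j`. -/
def gather {p₀ : JoinPt X r} (a : supp p₀ → Fin r) :
    C(unitInterval × JoinPt X r, JoinPt X r) where
  toFun y := (⟨gatherWt a y.1 y.2, fun i => add_nonneg
      (mul_nonneg (sub_nonneg.2 y.1.2.2) (wt_nonneg _ _))
      (mul_nonneg y.1.2.1 (Finset.sum_nonneg fun j _ => by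
        split_ifs
        · exact mass_nonneg _ _
        · exact le_rfl)), by
      simp only [gatherWt, Finset.sum_add_distrib, ← Finset.mul_sum, sum_wt]
      rw [Finset.sum_comm]
      simp only [Finset.sum_ite_eq, Finset.mem_univ, if_true]
      rw [Finset.sum_coe_sort (supp p₀) (mass p₀), sum_supp_mass]
      ring⟩, ps y.2)
  continuous_toFun := by
    refine continuous_joinPt (fun i => ?_) fun i => ?_
    swap
    · have : Continuous fun y : unitInterval × JoinPt X r => ps y.2 i :=
        (continuous_ps i).comp continuous_snd
      exact this
    have hs : Continuous fun y : unitInterval × JoinPt X r => (y.1 : ℝ) :=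
      continuous_subtype_val.comp continuous_fst
    exact ((continuous_const.sub hs).mul ((continuous_wt i).comp continuous_snd)).add
      (hs.mul continuous_const)

variable {p₀ : JoinPt X r} {a : supp p₀ → Fin r}

lemma wt_gather (y : unitInterval × JoinPt X r) (i : Fin r) :
    wt (gather a y) i = (1 - (y.1 : ℝ)) * wt y.2 i +
      y.1 * ∑ j, if a j = i then mass p₀ j else 0 := rfl

lemma ps_gather (y : unitInterval × JoinPt X r) (i : Fin r) : ps (gather a y) i = ps y.2 i := rfl

lemma gather_zero (p : JoinPt X r) : gather a (0, p) = p :=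
  joinPt_ext (fun i => by simp [wt_gather]) fun _ => rfl

lemma IsPeak.wt_gather_eq_zero {p : JoinPt X r} (h : IsPeak a p) {i : Fin r} (hi : wt p i = 0)
    (s : unitInterval) : wt (gather a (s, p)) i = 0 := by
  rw [wt_gather, h.sum_eq_zero hi]
  simp [hi]

lemma IsPeak.mass_gather {p : JoinPt X r} (h : IsPeak a p) (hp : ∀ z, mass p z = mass p₀ z)
    (s : unitInterval) (z : X) : mass (gather a (s, p)) z = mass p₀ z := by
  have h1 : ∑ i, (if ps p i = z then ∑ j, (if a j = i then mass p₀ j else 0) else 0) =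
      mass p₀ z := by
    have : ∀ i, (if ps p i = z then ∑ j, (if a j = i then mass p₀ j else 0) else 0) =
        ∑ j, if a j = i then (if (j : X) = z then mass p₀ j else 0) else 0 := fun i => by
      by_cases hz : ps p i = z
      · rw [if_pos hz]
        refine Finset.sum_congr rfl fun j _ => ?_
        by_cases hj : a j = i
        · rw [if_pos hj, if_pos hj, if_pos (by rw [← (h j).1, hj, hz])]
        · rw [if_neg hj, if_neg hj]
      · rw [if_neg hz]
        refine (Finset.sum_eq_zero fun j _ => ?_).symm
        by_cases hj : a j = i
        · rw [if_pos hj, if_neg fun hcon => hz (by rw [← hcon, ← (h j).1, hj])]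
        · rw [if_neg hj]
    simp only [this]
    rw [Finset.sum_comm]
    simp only [Finset.sum_ite_eq, Finset.mem_univ, if_true]
    rw [Finset.sum_coe_sort (supp p₀) fun j => if j = z then mass p₀ j else 0,
      Finset.sum_ite_eq', ite_eq_left_iff]
    intro hz
    by_contra hcon
    exact hz (mem_supp.2 (Ne.symm hcon))
  have h2 : mass (gather a (s, p)) z = (1 - (s : ℝ)) * mass p z + s *
      ∑ i, (if ps p i = z then ∑ j, (if a j = i then mass p₀ j else 0) else 0) := by
    simp only [mass, wt_gather, ps_gather, Finset.mul_sum, mul_ite, mul_zero,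
      ← Finset.sum_add_distrib]
    refine Finset.sum_congr rfl fun i _ => ?_
    split_ifs <;> simp
  rw [h2, h1, hp]
  ring

end Gather

variable {r : ℕ} {p₀ : JoinPt (Sph (Fin 3)) r} {a a' : supp p₀ → Fin r}

lemma IsPeak.sphQuotMap_gather_eq_of_eq {p : JoinPt (Sph (Fin 3)) r} (h : IsPeak a p)
    (h' : IsPeak a' p) (s : unitInterval) :
    sphQuotMap (gather a (s, p)) = sphQuotMap (gather a' (s, p)) := by
  let f : Fin r → Fin r := fun i =>
    if hi : ps p i ∈ supp p₀ then Equiv.swap (a ⟨_, hi⟩) (a' ⟨_, hi⟩) i else i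
  have hf1 : ∀ i (j : supp p₀), ps p i = j → f i = Equiv.swap (a j) (a' j) i := by
    rintro i ⟨j, hj⟩ (rfl : ps p i = j)
    exact dif_pos hj
  have hf2 : ∀ i, ps p i ∉ supp p₀ → f i = i := fun i hi => dif_neg hi
  have hps : ∀ i, ps p (f i) = ps p i := fun i => by
    by_cases hi : ps p i ∈ supp p₀
    · rw [hf1 i ⟨_, hi⟩ rfl]
      rw [Equiv.swap_apply_def]
      split_ifs with h1 h2
      · exact (h' ⟨_, hi⟩).1
      · exact (h ⟨_, hi⟩).1
      · rfl
    · rw [hf2 i hi]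
  have hwt : ∀ i, wt p (f i) = wt p i := fun i => by
    by_cases hi : ps p i ∈ supp p₀
    · rw [hf1 i ⟨_, hi⟩ rfl]
      have := le_antisymm ((h ⟨_, hi⟩).2.2 _ (h' ⟨_, hi⟩).1) ((h' ⟨_, hi⟩).2.2 _ (h ⟨_, hi⟩).1)
      rw [Equiv.swap_apply_def]
      split_ifs with h1 h2
      · rw [this, ← h1]
      · rw [← this, ← h2]
      · rfl
    · rw [hf2 i hi]
  have hinv : Function.Involutive f := fun i => by
    by_cases hi : ps p i ∈ supp p₀
    · rw [hf1 (f i) ⟨_, hi⟩ (hps i), hf1 i ⟨_, hi⟩ rfl, Equiv.swap_apply_self]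
    · rw [hf2 (f i) (by rwa [hps]), hf2 i hi]
  have hfa : ∀ j, f (a j) = a' j := fun j => by
    rw [hf1 _ j (h j).1, Equiv.swap_apply_left]
  refine sphQuotMap_eq_iff.2 ⟨hinv.toPerm f, fun i => ⟨?_, fun _ => (hps i).symm⟩⟩
  change wt _ i = wt _ (f i)
  rw [wt_gather, wt_gather]
  simp only [hwt, ← hfa, hinv.injective.eq_iff]

lemma IsPeak.sphQuotMap_gather_eq {p p' : JoinPt (Sph (Fin 3)) r} (h : IsPeak a p)
    (h' : IsPeak a' p') (hp : sphQuotMap p = sphQuotMap p') (s : unitInterval) :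
    sphQuotMap (gather a (s, p)) = sphQuotMap (gather a' (s, p')) := by
  obtain ⟨π, hπ⟩ := sphQuotMap_eq_iff.1 hp
  have hpk : IsPeak (fun j => π (a j)) p' := fun j => by
    refine ⟨?_, ?_, fun i hi => ?_⟩
    · rw [← (hπ (a j)).2 (h j).2.1, (h j).1]
    · rw [← (hπ (a j)).1]
      exact (h j).2.1
    · obtain ⟨k, rfl⟩ := π.surjective i
      rw [← (hπ k).1, ← (hπ (a j)).1]
      by_cases hk : wt p k = 0
      · rw [hk]
        exact wt_nonneg _ _
      · exact (h j).2.2 k (((hπ k).2 hk).trans hi)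
  refine Eq.trans ?_ (hpk.sphQuotMap_gather_eq_of_eq h' s)
  refine sphQuotMap_eq_iff.2 ⟨π, fun i => ⟨?_, fun hi => (hπ i).2 fun hi' => ?_⟩⟩
  · rw [wt_gather, wt_gather, ← (hπ i).1]
    simp only [π.injective.eq_iff]
  · exact hi (h.wt_gather_eq_zero hi' s)

lemma IsPeak.sphQuotMap_gather_one_eq {p p' : JoinPt (Sph (Fin 3)) r} (h : IsPeak a p)
    (h' : IsPeak a' p') : sphQuotMap (gather a (1, p)) = sphQuotMap (gather a' (1, p')) := by
  have hinj : ∀ {b : supp p₀ → Fin r} {q : JoinPt (Sph (Fin 3)) r}, IsPeak b q →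
      Function.Injective b := fun {b q} hb j j' hj => by
    rw [Subtype.ext_iff, ← (hb j).1, ← (hb j').1, hj]
  let e := (Equiv.ofInjective a (hinj h)).symm.trans (Equiv.ofInjective a' (hinj h'))
  have he : ∀ j, e.extendSubtype (a j) = a' j := fun j => by
    rw [Equiv.extendSubtype_apply_of_mem e (a j) (Set.mem_range_self j)]
    change ((Equiv.ofInjective a' (hinj h')) ((Equiv.ofInjective a (hinj h)).symm
      ⟨a j, Set.mem_range_self j⟩) : Fin r) = a' j
    rw [Equiv.ofInjective_symm_apply, Equiv.ofInjective_apply]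
  refine sphQuotMap_eq_iff.2 ⟨e.extendSubtype, fun i => ⟨?_, fun hi => ?_⟩⟩
  · rw [wt_gather, wt_gather]
    simp only [← he, e.extendSubtype.injective.eq_iff, Set.Icc.coe_one, sub_self, zero_mul]
  · rw [wt_gather] at hi
    obtain ⟨j, -, hj⟩ := Finset.exists_ne_zero_of_sum_ne_zero fun h0 => hi (by rw [h0]; simp)
    have hj' : a j = i := by
      by_contra hcon
      exact hj (if_neg hcon)
    rw [← hj', he, ps_gather, ps_gather, (h j).1, (h' j).1]

/-- The fibres of the projection to the self-join are contractible. -/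
lemma exists_fibre_contraction (p₀ : JoinPt (Sph (Fin 3)) r) :
    ∃ (w₀ : SphQuot (factorGroup r)) (HC : (incl (projMap r ⁻¹' {joinMap p₀})).Homotopy
      (ContinuousMap.const _ w₀)), ∀ y, projMap r (HC y) = joinMap p₀ := by
  obtain ⟨χ, ψ, hχ0, hχ1, hχJ, -, -, -⟩ := exists_bump_deformation (supp p₀)
  let P := (joinMap ⁻¹' {joinMap p₀} : Set (JoinPt (Sph (Fin 3)) r))
  have hm : ∀ p : P, ∀ z, mass p.1 z = mass p₀ z := fun p => joinMap_eq_iff.1 p.2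
  have hps : ∀ p : P, ∀ i, wt p.1 i ≠ 0 → ps p.1 i ∈ supp p₀ := fun p i hi => by
    rw [mem_supp, ← hm p]
    exact mass_ne_zero hi
  let C : (supp p₀ → Fin r) → Set P := fun a =>
    {p | ∀ (j : supp p₀) i, wt p.1 i * χ j (ps p.1 i) ≤ wt p.1 (a j) * χ j (ps p.1 (a j))}
  have hCc : ∀ a, IsClosed (C a) := fun a => by
    have hc : ∀ (j : supp p₀) i, Continuous fun p : P => wt p.1 i * χ j (ps p.1 i) := fun j i =>
      ((continuous_wt i).comp continuous_subtype_val).mul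
        ((χ j).continuous.comp ((continuous_ps i).comp continuous_subtype_val))
    simp only [C, Set.ofPred_forall]
    exact isClosed_iInter fun j => isClosed_iInter fun i => isClosed_le (hc j i) (hc j (a j))
  have hCpk : ∀ a, ∀ p ∈ C a, IsPeak a p.1 := fun a p hp j => by
    have hpos : 0 < wt p.1 (a j) * χ j (ps p.1 (a j)) := by
      obtain ⟨i, -, hi⟩ := Finset.exists_ne_zero_of_sum_ne_zero
        ((hm p j).trans_ne (mem_supp.1 j.2))
      have hij : ps p.1 i = j := by
        by_contra hcon
        exact hi (if_neg hcon)
      rw [if_pos hij] at hi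
      refine lt_of_lt_of_le ?_ (hp j i)
      rw [hij, hχ1, mul_one]
      exact (wt_nonneg _ _).lt_of_ne' hi
    have h1 : wt p.1 (a j) ≠ 0 := fun h => by simp [h] at hpos
    have h2 : ps p.1 (a j) = j := by
      by_contra hcon
      rw [hχJ j j.2 _ (hps p _ h1) (Ne.symm hcon), mul_zero] at hpos
      exact hpos.false
    refine ⟨h2, h1, fun i hi => ?_⟩
    have := hp j i
    rwa [hi, h2, hχ1, mul_one, mul_one] at this
  have hCex : ∀ p, ∃ a, p ∈ C a := fun p => by
    have : Nonempty (Fin r) := by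
      obtain ⟨i, -⟩ := Finset.exists_ne_zero_of_sum_ne_zero ((sum_wt p₀).trans_ne one_ne_zero)
      exact ⟨i⟩
    choose a ha using fun j : supp p₀ =>
      Finite.exists_max fun i => wt p.1 i * χ j (ps p.1 i)
    exact ⟨a, ha⟩
  choose α hα using hCex
  have hpk : ∀ p, IsPeak (α p) p.1 := fun p => hCpk _ _ (hα p)
  let k : C(unitInterval × P, SphQuot (factorGroup r)) :=
    ⟨fun y => sphQuotMap (gather (α y.2) (y.1, y.2.1)), by
      refine LocallyFinite.continuous (f := fun a => Prod.snd ⁻¹' C a) (locallyFinite_of_finite _)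
        (Set.eq_univ_of_forall fun y => Set.mem_iUnion.2 ⟨_, hα y.2⟩)
        (fun a => (hCc a).preimage continuous_snd) fun a => ?_
      have hc : Continuous fun y : unitInterval × P => sphQuotMap (gather a (y.1, y.2.1)) := by
        fun_prop
      exact hc.continuousOn.congr fun y hy =>
        (hpk y.2).sphQuotMap_gather_eq_of_eq (hCpk a _ hy) _⟩
  have hk : ∀ s p, k (s, p) = sphQuotMap (gather (α p) (s, p.1)) := fun _ _ => rfl
  have hPc : CompactSpace P :=
    isCompact_iff_compactSpace.1 (isClosed_singleton.preimage joinMap.continuous).isCompact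
  have hmem : ∀ p : P, sphQuotMap p.1 ∈ projMap r ⁻¹' {joinMap p₀} := fun p => by
    rw [Set.mem_preimage, projMap_sphQuotMap]
    exact p.2
  obtain ⟨HC, hHC⟩ := exists_desc
    (⟨fun y => (y.1, ⟨sphQuotMap y.2.1, hmem y.2⟩), by fun_prop⟩ :
      C(unitInterval × P, unitInterval × (projMap r ⁻¹' {joinMap p₀}))) (by
      rintro ⟨s, μ, hμ⟩
      obtain ⟨p, rfl⟩ := sphQuotMap_surjective μ
      rw [Set.mem_preimage, projMap_sphQuotMap] at hμ
      exact ⟨(s, ⟨p, hμ⟩), rfl⟩) k (by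
      rintro ⟨s, p⟩ ⟨s', p'⟩ hpp
      obtain ⟨rfl, h2⟩ := Prod.mk.inj hpp
      exact (hpk p).sphQuotMap_gather_eq (hpk p') (congrArg Subtype.val h2) _)
  have hlift : ∀ y : (projMap r ⁻¹' {joinMap p₀} : Set (SphQuot (factorGroup r))),
      ∃ p : P, sphQuotMap p.1 = y := by
    rintro ⟨μ, hμ⟩
    obtain ⟨p, rfl⟩ := sphQuotMap_surjective μ
    rw [Set.mem_preimage, projMap_sphQuotMap] at hμ
    exact ⟨⟨p, hμ⟩, rfl⟩
  have hHC' : ∀ s (y : (projMap r ⁻¹' {joinMap p₀} : Set (SphQuot (factorGroup r)))) (p : P),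
      sphQuotMap p.1 = y → HC (s, y) = k (s, p) := by
    rintro s ⟨_, hy⟩ p rfl
    exact hHC (s, p)
  let q : P := ⟨p₀, rfl⟩
  refine ⟨k (1, q), ⟨HC, fun y => ?_, fun y => ?_⟩, ?_⟩
  · obtain ⟨p, hp⟩ := hlift y
    refine (hHC' 0 y p hp).trans ?_
    rw [hk, gather_zero, hp]
    rfl
  · obtain ⟨p, hp⟩ := hlift y
    exact (hHC' 1 y p hp).trans ((hpk p).sphQuotMap_gather_one_eq (hpk q))
  · rintro ⟨s, y⟩
    obtain ⟨p, hp⟩ := hlift y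
    refine (congrArg (projMap r) (hHC' s y p hp)).trans ?_
    rw [hk, projMap_sphQuotMap]
    exact joinMap_eq_iff.2 ((hpk p).mass_gather (hm p) s)

end

section

variable {r : ℕ}

/-- Preimages of small neighbourhoods in the self-join contract to points. -/
lemma exists_projMap_homotopy (μ : SelfJoin (Sph (Fin 3)) r)
    {U : Set (SelfJoin (Sph (Fin 3)) r)} (hU : U ∈ nhds μ) :
    ∃ V ∈ nhds μ, ∃ (w₀ : SphQuot (factorGroup r)) (H : (incl (projMap r ⁻¹' V)).Homotopy
      (ContinuousMap.const _ w₀)), ∀ y, projMap r (H y) ∈ U := by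
  obtain ⟨p₀, rfl⟩ := joinMap_surjective μ
  obtain ⟨K, hK, hKc, HZ, hHZ, g, HW, hHW⟩ := exists_join_contraction p₀
  obtain ⟨w₀, HC, hHC⟩ := exists_fibre_contraction p₀
  have hg : ∀ y, projMap r (g y) = joinMap p₀ := fun y => by
    rw [← HW.apply_one, hHW, HZ.apply_one, ContinuousMap.const_apply]
  let g' : C(projMap r ⁻¹' K, projMap r ⁻¹' {joinMap p₀}) :=
    ⟨fun y => ⟨g y, hg y⟩, g.continuous.subtype_mk _⟩
  let H' : g.Homotopy (ContinuousMap.const (projMap r ⁻¹' K) w₀) := HC.compContinuousMap g'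
  have hH' : ∀ y, projMap r (H' y) = joinMap p₀ := fun y => hHC _
  obtain ⟨V, hV, hVK, H, hH⟩ := exists_small_homotopy (projMap r) hK hKc (HW.trans H') (by
    rintro ⟨s, y⟩ hy
    rw [ContinuousMap.Homotopy.trans_apply]
    split_ifs
    · rw [hHW]
      exact hHZ _ hy
    · exact hH' _) hU
  exact ⟨V, hV, w₀, H, hH⟩

lemma locContr_projMap : LocContr (projMap r) := fun μ U hU => by
  obtain ⟨V, hV, w₀, H, hH⟩ := exists_projMap_homotopy μ hU
  exact ⟨V, hV, _, H, IsLocallyConstant.const _, hH⟩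

lemma locContr_selfJoin : LocContr (id : SelfJoin (Sph (Fin 3)) r → _) := fun μ U hU => by
  obtain ⟨p₀, rfl⟩ := joinMap_surjective μ
  obtain ⟨K, hK, hKc, HZ, hHZ, -⟩ := exists_join_contraction p₀
  obtain ⟨V, hV, hVK, H, hH⟩ := exists_small_homotopy (ContinuousMap.id _) hK hKc HZ hHZ hU
  exact ⟨V, hV, _, H, IsLocallyConstant.const _, hH⟩

/-- A chosen point over each point of the self-join. -/
def liftPt (μ : SelfJoin (Sph (Fin 3)) r) : Ch 1 (SphQuot (factorGroup r)) :=
  pt (Function.surjInv projMap_surjective μ)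

lemma liftPt_mem_Car (μ : SelfJoin (Sph (Fin 3)) r) :
    liftPt μ ∈ Car 1 (projMap r ⁻¹' {μ}) :=
  pt_mem_Car (Function.surjInv_eq projMap_surjective μ)

lemma push_projMap_liftPt (μ : SelfJoin (Sph (Fin 3)) r) :
    push (projMap r) (liftPt μ) = pt μ := by
  rw [liftPt, push_pt, Function.surjInv_eq projMap_surjective]

lemma lift₀_liftPt : Lift₀ id (projMap r) liftPt := by
  refine Lift₀.of_local fun μ U hU => ?_
  obtain ⟨V, hV, w₀, H, hH⟩ := exists_projMap_homotopy μ hU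
  refine ⟨V, hV, fun z z' hz hz' => ?_⟩
  have hmem : ∀ w ∈ V, Function.surjInv projMap_surjective w ∈ projMap r ⁻¹' V := fun w hw => by
    rwa [Set.mem_preimage, Function.surjInv_eq projMap_surjective]
  obtain ⟨y, hy, hdy⟩ := exists_dC_eq (U := projMap r ⁻¹' U) H (IsLocallyConstant.const _) hH
    (pt ⟨_, hmem z' hz'⟩ - pt ⟨_, hmem z hz⟩)
    (by rw [map_sub, push_pt, push_pt]; exact sub_self _)
  refine ⟨y, hy, ?_⟩
  rw [hdy, map_sub, push_pt, push_pt]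
  rfl

end

section

/-! ### Vanishing of the homology -/

section Chains

variable {Z T T' B B' : Type} [TopologicalSpace Z] [TopologicalSpace T] [TopologicalSpace T']

lemma single_eq_pt (σ : C(Spl 1, Z)) :
    Finsupp.single σ 1 = pt (σ (stdSimplex.vertex 0)) := by
  rw [pt]
  congr 1
  ext x
  rw [Subsingleton.elim x (stdSimplex.vertex 0)]
  rfl

lemma push_mem_Car (g : C(T, T')) {A : Set T} {A' : Set T'} (h : ∀ t ∈ A, g t ∈ A') {n : ℕ}
    {x : Ch n T} (hx : x ∈ Car n A) : push g x ∈ Car n A' := by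
  refine supported_le_of_single (f := push g) (N := Car n A') (fun σ hσ => ?_) hx
  rw [push_single]
  exact Finsupp.single_mem_supported _ _ fun y => h _ (hσ y)

lemma single_mem_Over [PseudoMetricSpace B] {p : Z → B} {η : ℝ} {n : ℕ} {σ : C(Spl n, Z)}
    (hσ : σ ∈ Small p η n) (x : Spl n) : Finsupp.single σ 1 ∈ Over p n (p (σ x)) η :=
  Finsupp.single_mem_supported _ _ fun _ => hσ _ _

lemma Small_mono [PseudoMetricSpace B] {p : Z → B} {δ δ' : ℝ} (h : δ ≤ δ') (n : ℕ) :
    Small p δ n ⊆ Small p δ' n := fun _ hσ x y => (hσ x y).trans_le h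

end Chains

variable {r : ℕ}

/-- Cycles of the self-join lift to the quotient sphere up to boundaries. -/
lemma exists_projMap_lift {N : ℕ} {c : Ch (N + 2) (SelfJoin (Sph (Fin 3)) r)} (hc : dC c = 0) :
    ∃ d : Ch (N + 2) (SphQuot (factorGroup r)), dC d = 0 ∧
      push (projMap r) d - c ∈ bd (N + 2) (SelfJoin (Sph (Fin 3)) r) := by
  obtain ⟨η, hη, key⟩ := exists_forall_mem_bd locContr_selfJoin.locAcyc
    (id : SelfJoin (Sph (Fin 3)) r → _) N
  obtain ⟨δ, hδ, s, hs0, hs1, hs2⟩ := exists_carried_chainMap locContr_projMap.locAcyc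
    liftPt_mem_Car lift₀_liftPt (N + 1) hη
  obtain ⟨c', hc's, hc', hcc'⟩ := exists_small_cycle
    (p := (id : SelfJoin (Sph (Fin 3)) r → _)) continuous_id (lt_min hδ hη) hc
  have hsδ : ∀ n, Small id (min δ η) n ⊆ Small (id : SelfJoin (Sph (Fin 3)) r → _) δ n :=
    Small_mono (min_le_left _ _)
  have hsη : ∀ n, Small id (min δ η) n ⊆ Small (id : SelfJoin (Sph (Fin 3)) r → _) η n :=
    Small_mono (min_le_right _ _)
  refine ⟨s (N + 1) c', ?_, ?_⟩
  · have := eq_of_supported (f := dC ∘ₗ s (N + 1)) (g := s N ∘ₗ dC)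
      (fun σ hσ => hs2 N N.lt_succ_self σ (hsδ _ hσ)) hc's
    simpa [hc'] using this
  · have h1 := key (fun n => Small id (min δ η) n) (fun n σ hσ j => Small.face hσ j) hsη
      (fun n => push (projMap r) ∘ₗ s n - LinearMap.id) (fun σ => by
        rw [LinearMap.sub_apply, LinearMap.comp_apply, hs0, onPoints_single, push_projMap_liftPt,
          LinearMap.id_apply, ← single_eq_pt, sub_self])
      (fun n hn σ hσ x => Submodule.sub_mem _
        (push_mem_Car (projMap r) (fun _ ht => ht) (hs1 n hn σ (hsδ _ hσ) x))
        (single_mem_Over (hsη _ hσ) x))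
      (fun n hn σ hσ => by
        simp only [LinearMap.sub_apply, LinearMap.comp_apply, LinearMap.id_apply, map_sub,
          push_dC, hs2 n hn σ (hsδ _ hσ)]) c' hc's hc'
    have h2 : push (projMap r) (s (N + 1) c') - c =
        push (projMap r) (s (N + 1) c') - c' - (c - c') := by
      abel
    rw [h2]
    exact Submodule.sub_mem _ h1 hcc'

/-- Transfer of cycles of the quotient sphere to the sphere. -/
lemma exists_transfer {m : ℂ} (hm : ∀ w, push (quotMap (factorGroup r))
    (orbitSum (factorGroup r) w) = m • pt w) (γ : factorGroup r) {N : ℕ}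
    {d : Ch (N + 2) (SphQuot (factorGroup r))}
    (hd : dC d = 0) :
    ∃ z : Ch (N + 2) (Sph (Fin r × Fin 3)), dC z = 0 ∧
      push (permMap (γ : Equiv.Perm (Fin r × Fin 3))) z - z ∈ bd (N + 2) (Sph (Fin r × Fin 3)) ∧
      push (projMap r) (push (quotMap (factorGroup r)) z) -
        m • push (projMap r) d ∈
          bd (N + 2) (SelfJoin (Sph (Fin 3)) r) := by
  obtain ⟨η, hη, key⟩ := exists_forall_mem_bd locContr_selfJoin.locAcyc (projMap r) N
  obtain ⟨η', hη', key'⟩ := exists_forall_mem_bd (locContr_quotMap (factorGroup r)).locAcyc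
    (id : SphQuot (factorGroup r) → _) N
  obtain ⟨θ, hθ, hθη⟩ := Metric.uniformContinuous_iff.1
    (CompactSpace.uniformContinuous_of_continuous (projMap r).continuous) η hη
  obtain ⟨δ, hδ, s, hs0, hs1, hs2⟩ := exists_carried_chainMap
    (locContr_quotMap (factorGroup r)).locAcyc (orbitSum_mem_Car (factorGroup r))
    (lift₀_orbitSum (factorGroup r)) (N + 1) (lt_min hη' hθ)
  set ε := min δ (min η' θ) with hε
  obtain ⟨d', hd's, hd', hdd'⟩ := exists_small_cycle
    (p := (id : SphQuot (factorGroup r) → _)) continuous_id (lt_min hδ (lt_min hη' hθ)) hd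
  have hsδ : ∀ n, Small id ε n ⊆ Small (id : SphQuot (factorGroup r) → _) δ n :=
    Small_mono (min_le_left _ _)
  have hsη' : ∀ n, Small id ε n ⊆ Small (id : SphQuot (factorGroup r) → _) η' n :=
    Small_mono ((min_le_right _ _).trans (min_le_left _ _))
  have hsη : ∀ n, Small id ε n ⊆ Small (projMap r) η n := fun n σ hσ x y =>
    hθη ((hσ x y).trans_le ((min_le_right _ _).trans (min_le_right _ _)))
  refine ⟨s (N + 1) d', ?_, ?_, ?_⟩
  · have := eq_of_supported (f := dC ∘ₗ s (N + 1)) (g := s N ∘ₗ dC)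
      (fun σ hσ => hs2 N N.lt_succ_self σ (hsδ _ hσ)) hd's
    simpa [hd'] using this
  · exact key' (fun n => Small id ε n) (fun n σ hσ j => Small.face hσ j) hsη'
      (fun n => push (permMap (γ : Equiv.Perm (Fin r × Fin 3))) ∘ₗ s n - s n) (fun σ => by
        rw [LinearMap.sub_apply, LinearMap.comp_apply, hs0, onPoints_single,
          push_smul_orbitSum, sub_self])
      (fun n hn σ hσ x => by
        have h1 := hs1 n hn σ (hsδ _ hσ) x
        have h2 : s n (Finsupp.single σ 1) ∈ Over (quotMap (factorGroup r)) (n + 1) (σ x) η' :=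
          Over_mono (by rw [dist_self, zero_add]; exact min_le_left _ _) h1
        refine Submodule.sub_mem _ (push_mem_Car _ (fun t ht => ?_) h2) h2
        rw [Set.mem_preimage] at ht ⊢
        rwa [show permMap (γ : Equiv.Perm (Fin r × Fin 3)) t = γ • t from rfl, quotMap_smul])
      (fun n hn σ hσ => by
        simp only [LinearMap.sub_apply, LinearMap.comp_apply, map_sub,
          push_dC, hs2 n hn σ (hsδ _ hσ)]) d' hd's hd'
  · have h1 := key (fun n => Small id ε n) (fun n σ hσ j => Small.face hσ j) hsη
      (fun n => push (projMap r) ∘ₗ (push (quotMap (factorGroup r)) ∘ₗ s n -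
        m • LinearMap.id)) (fun σ => by
        rw [LinearMap.comp_apply, LinearMap.sub_apply, LinearMap.comp_apply, hs0, onPoints_single,
          hm, LinearMap.smul_apply, LinearMap.id_apply, ← single_eq_pt]
        exact (congrArg _ (sub_self _)).trans (map_zero _))
      (fun n hn σ hσ x => by
        rw [LinearMap.comp_apply, LinearMap.sub_apply, map_sub, LinearMap.smul_apply, map_smul]
        refine Submodule.sub_mem _ (push_mem_Car _ (fun t ht => ?_)
          (push_mem_Car (A' := Metric.ball (σ x) θ) _ (fun t ht => ?_)
            (hs1 n hn σ (hsδ _ hσ) x))) (Submodule.smul_mem _ _ ?_)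
        · exact hθη ht
        · exact Metric.ball_subset_ball (min_le_right _ _) ht
        · rw [LinearMap.id_apply, push_single]
          exact Finsupp.single_mem_supported _ _ fun _ => hsη _ hσ _ _)
      (fun n hn σ hσ => by
        simp only [LinearMap.sub_apply, LinearMap.comp_apply, LinearMap.id_apply, map_sub,
          LinearMap.smul_apply, map_smul, push_dC, hs2 n hn σ (hsδ _ hσ)]) d' hd's hd'
    have h2 : push (projMap r) (push (quotMap (factorGroup r)) (s (N + 1) d')) -
        m • push (projMap r) d =
        push (projMap r) (push (quotMap (factorGroup r)) (s (N + 1) d') -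
          m • d') -
          m • push (projMap r) (d - d') := by
      simp only [map_sub, map_smul, smul_sub]
      abel
    rw [h2]
    exact Submodule.sub_mem _ h1 (Submodule.smul_mem _ _ (push_mem_bd _ hdd'))

lemma prodPerm_swap (i j : Fin r) : prodPerm r (Equiv.swap i j) =
    Equiv.swap (i, (0 : Fin 3)) (j, 0) * (Equiv.swap (i, 1) (j, 1) *
      Equiv.swap (i, 2) (j, 2)) := by
  ext1 ⟨k, a⟩
  change (Equiv.swap i j k, a) = _
  rw [Equiv.Perm.mul_apply, Equiv.Perm.mul_apply]
  by_cases hi : k = i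
  · subst hi
    rw [Equiv.swap_apply_left]
    fin_cases a <;> simp [Equiv.swap_apply_def]
  · by_cases hj : k = j
    · subst hj
      rw [Equiv.swap_apply_right]
      fin_cases a <;> simp [Equiv.swap_apply_def, hi]
    · rw [Equiv.swap_apply_of_ne_of_ne hi hj]
      simp [Equiv.swap_apply_def, hi, hj]

lemma push_permMap_mul {ι : Type} [Fintype ι] (π π' : Equiv.Perm ι) {n : ℕ} (x : Ch n (Sph ι)) :
    push (permMap (π * π')) x = push (permMap π) (push (permMap π') x) := by
  rw [push_comp]
  rfl

/-- Exchanging two factors reverses the sign of every homology class. -/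
lemma add_push_prodPerm_swap_mem_bd {i j : Fin r} (hij : i ≠ j) {N : ℕ}
    {z : Ch (N + 2) (Sph (Fin r × Fin 3))} (hz : dC z = 0) :
    z + push (permMap (prodPerm r (Equiv.swap i j))) z ∈ bd (N + 2) (Sph (Fin r × Fin 3)) := by
  have hne : ∀ a : Fin 3, (i, a) ≠ (j, a) := fun a h => hij (Prod.mk.inj h).1
  have hcyc : ∀ (π : Equiv.Perm (Fin r × Fin 3)) {x : Ch (N + 2) (Sph (Fin r × Fin 3))},
      dC x = 0 → dC (push (permMap π) x) = 0 := fun π x hx => by rw [push_dC, hx, map_zero]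
  have hswap : ∀ (a : Fin 3) {x : Ch (N + 2) (Sph (Fin r × Fin 3))}, dC x = 0 →
      x + push (permMap (Equiv.swap (i, a) (j, a))) x ∈ bd (N + 2) (Sph (Fin r × Fin 3)) :=
    fun a x hx => by convert add_push_swap_mem_bd (hne a) hx
  have h2 := hswap 2 hz
  have hz2 := hcyc (Equiv.swap (i, 2) (j, 2)) hz
  have h1 := hswap 1 hz2
  have h0 := hswap 0 (hcyc (Equiv.swap (i, 1) (j, 1)) hz2)
  rw [prodPerm_swap, push_permMap_mul, push_permMap_mul]
  have key : ∀ x y w : Ch (N + 2) (Sph (Fin r × Fin 3)),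
      z + w = z + x - (x + y) + (y + w) := fun x y w => by abel
  rw [key (push (permMap (Equiv.swap (i, 2) (j, 2))) z)]
  exact Submodule.add_mem _ (Submodule.sub_mem _ h2 h1) h0

lemma mem_bd_of_dC_eq_zero (hr : 1 < r) {N : ℕ} {c : Ch (N + 2) (SelfJoin (Sph (Fin 3)) r)}
    (hc : dC c = 0) : c ∈ bd (N + 2) (SelfJoin (Sph (Fin 3)) r) := by
  obtain ⟨d, hd, hdc⟩ := exists_projMap_lift hc
  have hij : (⟨0, by omega⟩ : Fin r) ≠ ⟨1, hr⟩ := by simp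
  obtain ⟨m, hm0, hm⟩ : ∃ m : ℂ, m ≠ 0 ∧ ∀ w,
      push (quotMap (factorGroup r)) (orbitSum (factorGroup r) w) = m • pt w :=
    ⟨_, Nat.cast_ne_zero.2 (@Fintype.card_ne_zero _ (_) _),
      push_quotMap_orbitSum (factorGroup r)⟩
  obtain ⟨z, hz, hzγ, hzd⟩ := exists_transfer hm
    ⟨prodPerm r (Equiv.swap (⟨0, by omega⟩ : Fin r) ⟨1, hr⟩), _, rfl⟩ hd
  have h2 : (2 : ℂ) • z ∈ bd (N + 2) (Sph (Fin r × Fin 3)) := by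
    convert Submodule.sub_mem _ (add_push_prodPerm_swap_mem_bd hij hz) hzγ using 1
    rw [two_smul]
    abel
  have hzb := (Submodule.smul_mem_iff _ (two_ne_zero (α := ℂ))).1 h2
  have hd' := (Submodule.smul_mem_iff _ hm0).1
    ((Submodule.sub_mem_iff_right _ (push_mem_bd _ (push_mem_bd _ hzb))).1 hzd)
  exact (Submodule.sub_mem_iff_right _ hd').1 hdc

end

section

lemma face_apply {n : ℕ} (j : Fin (n + 1)) (x : Spl n) :
    face j x = stdSimplex.map j.succAbove x := by
  ext k
  rw [face, aff_apply, stdSimplex.map_coe, FunOnFinite.linearMap_apply_apply, Finset.sum_filter]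
  refine Finset.sum_congr rfl fun i _ => ?_
  rw [stdSimplex.vertex_coe, Pi.single_apply]
  simp [eq_comm]

variable (X : TopCat.{0})

/-- Singular chains as formal linear combinations of continuous maps. -/
def chainsEquiv (n : ℕ) : ((singularChainComplexFunctor ℂ).obj X).X n ≃ₗ[ℂ] Ch (n + 1) X :=
  Finsupp.domLCongr (X.toSSetObjEquiv (Opposite.op (SimplexCategory.mk n)))

lemma hom_sum_free_map {A B : Type} {n : ℕ} (f : Fin n → (A ⟶ B)) (x : A →₀ ℂ) :
    (∑ j : Fin n, (-1 : ℤ) ^ (j : ℕ) • (ModuleCat.free ℂ).map (f j)).hom x =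
      altSum (fun j a => f j a) x := by
  have h : ∀ j : Fin n, ((-1 : ℤ) ^ (j : ℕ) • (ModuleCat.free ℂ).map (f j)).hom =
      ((-1 : ℂ) ^ (j : ℕ) • Finsupp.lmapDomain ℂ ℂ (fun a => f j a) :
        (A →₀ ℂ) →ₗ[ℂ] (B →₀ ℂ)) := fun j => by
    have hz : ∀ φ : (A →₀ ℂ) →ₗ[ℂ] (B →₀ ℂ),
        (-1 : ℤ) ^ (j : ℕ) • φ = (-1 : ℂ) ^ (j : ℕ) • φ := fun φ => by
      rw [← Int.cast_smul_eq_zsmul ℂ]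
      push_cast
      rfl
    rw [ModuleCat.hom_zsmul]
    exact hz _
  rw [ModuleCat.hom_sum]
  exact congrArg (fun φ : (A →₀ ℂ) →ₗ[ℂ] (B →₀ ℂ) => φ x) (Finset.sum_congr rfl fun j _ => h j)

lemma chainsEquiv_apply (n : ℕ) (x : ((singularChainComplexFunctor ℂ).obj X).X n) :
    chainsEquiv X n x = Finsupp.lmapDomain ℂ ℂ
      (X.toSSetObjEquiv (Opposite.op (SimplexCategory.mk n))) x :=
  Finsupp.equivMapDomain_eq_mapDomain _ _

lemma chainsEquiv_d (n : ℕ) (x : ((singularChainComplexFunctor ℂ).obj X).X (n + 1)) :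
    chainsEquiv X n (((singularChainComplexFunctor ℂ).obj X).d (n + 1) n x) =
      dC (chainsEquiv X (n + 1) x) := by
  have hd : ((singularChainComplexFunctor ℂ).obj X).d (n + 1) n =
      ∑ j : Fin (n + 2), (-1 : ℤ) ^ (j : ℕ) •
        (ModuleCat.free ℂ).map ((TopCat.toSSet.obj X).δ j) :=
    AlgebraicTopology.AlternatingFaceMapComplex.obj_d_eq _ n
  rw [hd]
  refine (congrArg (chainsEquiv X n) (hom_sum_free_map _ x)).trans ?_
  refine (chainsEquiv_apply X n _).trans
    (Eq.trans ?_ (congrArg dC (chainsEquiv_apply X (n + 1) x).symm))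
  refine (altSum_mapDomain _ _ (X.toSSetObjEquiv (Opposite.op (SimplexCategory.mk (n + 1))))
    (X.toSSetObjEquiv (Opposite.op (SimplexCategory.mk n))) (fun j a => ?_) x).symm
  refine ContinuousMap.ext fun z => ?_
  change X.toSSetObjEquiv _ a (face j z) = _
  rw [face_apply]
  rfl

lemma subsingleton_singularHomology (n : ℕ)
    (h : ∀ c : Ch (n + 2) X, dC c = 0 → c ∈ bd (n + 2) X) :
    Subsingleton ((singularHomology ℂ (n + 1)).obj X) := by
  refine ModuleCat.subsingleton_of_isZero ?_
  change Limits.IsZero (((singularChainComplexFunctor ℂ).obj X).homology (n + 1))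
  rw [← HomologicalComplex.exactAt_iff_isZero_homology,
    HomologicalComplex.exactAt_iff' _ (n + 2) (n + 1) n (by simp) (by simp),
    ShortComplex.moduleCat_exact_iff]
  intro x hx
  obtain ⟨y, hy⟩ := h (chainsEquiv X (n + 1) x)
    ((chainsEquiv_d X n x).symm.trans ((congrArg _ hx).trans (map_zero _)))
  refine ⟨(chainsEquiv X (n + 2)).symm y, (chainsEquiv X (n + 1)).injective ?_⟩
  refine (chainsEquiv_d X (n + 1) _).trans ?_
  rw [LinearEquiv.apply_symm_apply, hy]

end

end SelfJoinHomology

end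

/-- for `r > 1`, the reduced homology of the `r`-fold self-join `(S²)^{*r}` of
the 2-sphere with complex coefficients is trivial in all positive dimensions. -/
theorem statement4 (r : ℕ) (hr : 1 < r) (i : ℕ) (hi : 0 < i) :
    Subsingleton ((singularHomology ℂ i).obj
      (TopCat.of (SelfJoin (Metric.sphere (0 : EuclideanSpace ℝ (Fin 3)) 1) r))) := by
  obtain ⟨n, rfl⟩ := Nat.exists_eq_add_of_lt hi
  rw [zero_add]
  exact SelfJoinHomology.subsingleton_singularHomology _ n fun c hc =>
    SelfJoinHomology.mem_bd_of_dC_eq_zero hr hc
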